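/- arXiv:1309.1045 — 2 statements merged into one kernel-verified Lean document; each statement's English description precedes it below -/
import Mathlib

section
/- Let α ∈ (0,1) and ρ ∈ (0,1] with ρ ≤ 1/(2α). Then the function x ↦ x^{-1-α}·g_{α,ρ}(x^{-1}) is decreasing (antitone) on (0,∞). -/
open MeasureTheory Complex Set Filter

/-- The function `G_α` from Fourati's paper: for `z` in the slit plane,
`G_α(z) = (2πi)⁻¹ ∫_0^∞ (exp(-e^{-iπα} y^α z^{1-α}) - exp(-e^{iπα} y^α z^{1-α})) z⁻¹ e^{-y} dy`,
all complex powers being principal branches. -/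
noncomputable def Galpha (α : ℝ) (z : ℂ) : ℂ :=
  (2 * Real.pi * Complex.I)⁻¹ *
    ∫ y in Set.Ioi (0:ℝ),
      ((Complex.exp (-(Complex.exp (-(Real.pi * α : ℂ) * Complex.I)) * (y:ℂ) ^ (α:ℂ) * z ^ (1 - (α:ℂ))) -
        Complex.exp (-(Complex.exp ((Real.pi * α : ℂ) * Complex.I)) * (y:ℂ) ^ (α:ℂ) * z ^ (1 - (α:ℂ)))) / z) *
      Complex.exp (-(y:ℂ))

/-- The upper boundary value `G_α(-r^+)`. -/
noncomputable def GalphaPlus (α r : ℝ) : ℂ :=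
  (2 * Real.pi * Complex.I)⁻¹ *
    ∫ y in Set.Ioi (0:ℝ),
      ((Complex.exp ((r:ℂ) ^ (1 - (α:ℂ)) * (y:ℂ) ^ (α:ℂ)) -
        Complex.exp (Complex.exp (-(2 * Real.pi * α : ℂ) * Complex.I) * (r:ℂ) ^ (1 - (α:ℂ)) * (y:ℂ) ^ (α:ℂ))) / (r:ℂ)) *
      Complex.exp (-(y:ℂ))

/-- `θ_α(r) = -arg(G_α(-r^+))/π`. -/
noncomputable def thetaFun (α r : ℝ) : ℝ := -(GalphaPlus α r).arg / Real.pi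

/-- Zolotarev's integral formula for the density of the strictly `α`-stable
distribution with positivity parameter `ρ` (the integral is a real number; we take
the real part). -/
noncomputable def stableDensity (α ρ x : ℝ) : ℝ :=
  ((2 * Real.pi * Complex.I)⁻¹ *
    ∫ y in Set.Ioi (0:ℝ),
      ((Complex.exp (-(Complex.exp (-(Real.pi * ρ * α : ℂ) * Complex.I)) * (y:ℂ) ^ (α:ℂ) * (x:ℂ) ^ (-(α:ℂ))) -
        Complex.exp (-(Complex.exp ((Real.pi * ρ * α : ℂ) * Complex.I)) * (y:ℂ) ^ (α:ℂ) * (x:ℂ) ^ (-(α:ℂ)))) / (x:ℂ)) *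
      Complex.exp (-(y:ℂ))).re

/-- A function is completely monotone (on `(0,∞)`) if it is infinitely differentiable
there and `(-1)^n f^{(n)}(x) ≥ 0` for all `n` and `x > 0`. -/
def CompletelyMonotone (φ : ℝ → ℝ) : Prop :=
  ContDiffOn ℝ (⊤ : ℕ∞) φ (Set.Ioi 0) ∧
  ∀ (n : ℕ) (x : ℝ), 0 < x → 0 ≤ (-1 : ℝ) ^ n * iteratedDeriv n φ x

/-- A function `H` on `(0,∞)` is hyperbolically completely monotone if for every `u > 0`
the function `v ↦ H(uv)H(u/v)` is a completely monotone function of `v + 1/v`. -/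
def HCM (H : ℝ → ℝ) : Prop :=
  ∀ u : ℝ, 0 < u → ∃ φ : ℝ → ℝ, CompletelyMonotone φ ∧
    ∀ v : ℝ, 0 < v → H (u * v) * H (u / v) = φ (v + 1 / v)


open scoped Topology

/-- `h` is integrable, and its integrals against the exponentials `exp (-y * l)`, `y ≥ 0`,
have nonnegative real part. -/
structure LaplacePos {X : Type*} [MeasurableSpace X] (μ : Measure X) (l h : X → ℂ) : Prop where
  integrable : Integrable h μ
  nonneg : ∀ y : ℝ, 0 ≤ y → 0 ≤ (∫ s, Complex.exp (-(y * l s)) * h s ∂μ).re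

namespace LaplacePos

variable {X : Type*} [MeasurableSpace X] {μ : Measure X} {l h : X → ℂ}

theorem norm_exp_neg_mul_le {y δ : ℝ} (hy : 0 ≤ y) {z : ℂ} (hz : δ ≤ z.re) :
    ‖Complex.exp (-(y * z))‖ ≤ Real.exp (-(δ * y)) := by
  rw [Complex.norm_exp]
  simp only [neg_re, re_ofReal_mul]
  exact Real.exp_le_exp.2 (by nlinarith)

theorem integrable_exp_mul (hl : Measurable l) (hl0 : ∀ᵐ s ∂μ, 0 ≤ (l s).re)
    (hh : Integrable h μ) {y : ℝ} (hy : 0 ≤ y) :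
    Integrable (fun s => Complex.exp (-(y * l s)) * h s) μ := by
  refine hh.bdd_mul (c := 1) (by fun_prop) ?_
  filter_upwards [hl0] with s hs
  simpa using norm_exp_neg_mul_le hy hs

theorem const_mul (H : LaplacePos μ l h) {c : ℝ} (hc : 0 ≤ c) :
    LaplacePos μ l (fun s => c * h s) where
  integrable := H.integrable.const_mul _
  nonneg y hy := by
    have : ∀ s, Complex.exp (-(y * l s)) * (c * h s) = c * (Complex.exp (-(y * l s)) * h s) :=
      fun s => by ring
    simp_rw [this, integral_const_mul, re_ofReal_mul]
    exact mul_nonneg hc (H.nonneg y hy)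

theorem add (hl : Measurable l) (hl0 : ∀ᵐ s ∂μ, 0 ≤ (l s).re) {g : X → ℂ}
    (H : LaplacePos μ l h) (G : LaplacePos μ l g) :
    LaplacePos μ l (fun s => h s + g s) where
  integrable := H.integrable.add G.integrable
  nonneg y hy := by
    simp_rw [mul_add]
    rw [integral_add (integrable_exp_mul hl hl0 H.integrable hy)
      (integrable_exp_mul hl hl0 G.integrable hy), add_re]
    exact add_nonneg (H.nonneg y hy) (G.nonneg y hy)

theorem zero : LaplacePos μ l (fun _ => 0) where
  integrable := integrable_zero _ _ _
  nonneg y _ := by simp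

theorem of_tendsto (hl : Measurable l) (hl0 : ∀ᵐ s ∂μ, 0 ≤ (l s).re) {f : ℕ → X → ℂ}
    {bound : X → ℝ} (hf : ∀ n, LaplacePos μ l (f n)) (hb : Integrable bound μ)
    (hfb : ∀ n, ∀ᵐ s ∂μ, ‖f n s‖ ≤ bound s)
    (hlim : ∀ᵐ s ∂μ, Tendsto (fun n => f n s) atTop (𝓝 (h s))) : LaplacePos μ l h where
  integrable := by
    refine hb.mono' (aestronglyMeasurable_of_tendsto_ae atTop
      (fun n => (hf n).integrable.aestronglyMeasurable) hlim) ?_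
    filter_upwards [hlim, ae_all_iff.2 hfb] with s hs hs'
    exact le_of_tendsto hs.norm (Eventually.of_forall hs')
  nonneg y hy := by
    have key : Tendsto (fun n => ∫ s, Complex.exp (-(y * l s)) * f n s ∂μ) atTop
        (𝓝 (∫ s, Complex.exp (-(y * l s)) * h s ∂μ)) := by
      refine tendsto_integral_of_dominated_convergence bound
        (fun n => (integrable_exp_mul hl hl0 (hf n).integrable hy).aestronglyMeasurable) hb
        (fun n => ?_) ?_
      · filter_upwards [hfb n, hl0] with s hs h0
        rw [norm_mul]
        have h1 := norm_exp_neg_mul_le hy h0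
        simp only [zero_mul, neg_zero, Real.exp_zero] at h1
        nlinarith [norm_nonneg (f n s)]
      · filter_upwards [hlim] with s hs
        exact hs.const_mul _
    exact ge_of_tendsto ((Complex.continuous_re.tendsto _).comp key)
      (Eventually.of_forall fun n => (hf n).nonneg y hy)

theorem norm_laplace_le {k : ℝ → ℝ} {δ : ℝ} (hk0 : ∀ y ∈ Ioi (0 : ℝ), 0 ≤ k y)
    (hki : IntegrableOn (fun y => k y * Real.exp (-(δ * y))) (Ioi 0)) {z : ℂ} (hz : δ ≤ z.re) :
    ‖∫ y in Ioi (0 : ℝ), (k y : ℂ) * Complex.exp (-(y * z))‖ ≤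
      ∫ y in Ioi (0 : ℝ), k y * Real.exp (-(δ * y)) := by
  refine norm_integral_le_of_norm_le hki ?_
  filter_upwards [ae_restrict_mem measurableSet_Ioi] with y hy
  rw [norm_mul, norm_real, Real.norm_of_nonneg (hk0 y hy)]
  exact mul_le_mul_of_nonneg_left (norm_exp_neg_mul_le (le_of_lt hy) hz) (hk0 y hy)

theorem aestronglyMeasurable_laplace [SFinite μ] (hl : Measurable l) {k : ℝ → ℝ}
    (hk : Measurable k) : AEStronglyMeasurable
      (fun s => ∫ y in Ioi (0 : ℝ), (k y : ℂ) * Complex.exp (-(y * l s))) μ := by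
  have : StronglyMeasurable (Function.uncurry fun (s : X) (y : ℝ) =>
      (k y : ℂ) * Complex.exp (-(y * l s))) := by
    apply Measurable.stronglyMeasurable
    unfold Function.uncurry
    fun_prop
  exact (this.integral_prod_right (ν := volume.restrict (Ioi (0 : ℝ)))).aestronglyMeasurable

/-- Positivity is preserved under multiplication by the Laplace transform of a positive
density. -/
theorem laplace_mul [SFinite μ] (hl : Measurable l) {δ : ℝ} (hδ0 : 0 ≤ δ)
    (hδ : ∀ᵐ s ∂μ, δ ≤ (l s).re) {k : ℝ → ℝ} (hk : Measurable k)
    (hk0 : ∀ y ∈ Ioi (0 : ℝ), 0 ≤ k y)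
    (hki : IntegrableOn (fun y => k y * Real.exp (-(δ * y))) (Ioi 0))
    (H : LaplacePos μ l h) :
    LaplacePos μ l
      (fun s => (∫ y in Ioi (0 : ℝ), (k y : ℂ) * Complex.exp (-(y * l s))) * h s) where
  integrable := by
    refine H.integrable.bdd_mul (c := ∫ y in Ioi (0 : ℝ), k y * Real.exp (-(δ * y)))
      (aestronglyMeasurable_laplace hl hk) ?_
    filter_upwards [hδ] with s hs
    exact norm_laplace_le hk0 hki hs
  nonneg Y hY := by
    have hl0 : ∀ᵐ s ∂μ, 0 ≤ (l s).re := hδ.mono fun s hs => hδ0.trans hs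
    have e1 : ∀ s, Complex.exp (-(Y * l s)) *
        ((∫ y in Ioi (0 : ℝ), (k y : ℂ) * Complex.exp (-(y * l s))) * h s) =
        ∫ y in Ioi (0 : ℝ), (k y : ℂ) * (Complex.exp (-(((Y + y : ℝ) : ℂ) * l s)) * h s) := by
      intro s
      rw [← integral_mul_const, ← integral_const_mul]
      congr 1 with y
      have : -(((Y + y : ℝ) : ℂ) * l s) = -(Y * l s) + -(y * l s) := by push_cast; ring
      rw [this, Complex.exp_add]; ring
    simp_rw [e1]
    rw [integral_integral_swap]
    · simp_rw [integral_const_mul]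
      have e2 : ∀ g : ℝ → ℂ, IntegrableOn g (Ioi 0) → (∀ y ∈ Ioi (0 : ℝ), 0 ≤ (g y).re) →
          0 ≤ (∫ y in Ioi (0 : ℝ), g y).re := by
        intro g hg h0
        have := integral_re hg
        simp only [RCLike.re_eq_complex_re] at this
        rw [← this]
        exact setIntegral_nonneg measurableSet_Ioi h0
      by_cases hg : IntegrableOn (fun y : ℝ => (k y : ℂ) *
          ∫ s, Complex.exp (-(((Y + y : ℝ) : ℂ) * l s)) * h s ∂μ) (Ioi 0)
      · refine e2 _ hg fun y hy => ?_
        rw [re_ofReal_mul]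
        exact mul_nonneg (hk0 y hy) (H.nonneg _ (add_nonneg hY (le_of_lt hy)))
      · rw [integral_undef hg]; simp
    · have hb : Integrable (fun p : X × ℝ => ‖h p.1‖ * (k p.2 * Real.exp (-(δ * p.2))))
          (μ.prod (volume.restrict (Ioi 0))) := H.integrable.norm.mul_prod hki
      refine hb.mono' ?_ ?_
      · have h1 : AEStronglyMeasurable (fun p : X × ℝ => h p.1)
            (μ.prod (volume.restrict (Ioi (0 : ℝ)))) := H.integrable.aestronglyMeasurable.comp_fst
        have h2 : AEStronglyMeasurable (fun p : X × ℝ => (k p.2 : ℂ) *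
            Complex.exp (-(((Y + p.2 : ℝ) : ℂ) * l p.1)))
            (μ.prod (volume.restrict (Ioi (0 : ℝ)))) := by
          apply Measurable.aestronglyMeasurable
          fun_prop
        refine (h2.mul h1).congr (Eventually.of_forall fun p => ?_)
        simp [Function.uncurry, mul_assoc]
      · have a1 : ∀ᵐ p : X × ℝ ∂(μ.prod (volume.restrict (Ioi (0 : ℝ)))), δ ≤ (l p.1).re :=
          Measure.quasiMeasurePreserving_fst.ae hδ
        have a2 : ∀ᵐ p : X × ℝ ∂(μ.prod (volume.restrict (Ioi (0 : ℝ)))), p.2 ∈ Ioi (0 : ℝ) :=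
          Measure.quasiMeasurePreserving_snd.ae (ae_restrict_mem measurableSet_Ioi)
        filter_upwards [a1, a2] with p hp1 hp2
        have hp2' : 0 < p.2 := hp2
        simp only [Function.uncurry, norm_mul, norm_real, Real.norm_of_nonneg (hk0 _ hp2)]
        have h3 : ‖Complex.exp (-(((Y + p.2 : ℝ) : ℂ) * l p.1))‖ ≤ Real.exp (-(δ * p.2)) := by
          refine (norm_exp_neg_mul_le (by positivity) hp1).trans ?_
          gcongr
          linarith
        have := mul_le_mul_of_nonneg_left h3 (mul_nonneg (hk0 _ hp2) (norm_nonneg (h p.1)))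
        calc _ = k p.2 * ‖h p.1‖ * ‖Complex.exp (-(((Y + p.2 : ℝ) : ℂ) * l p.1))‖ := by ring
          _ ≤ _ := this
          _ = _ := by ring

/-- Positivity is preserved under multiplication by the exponential of the Laplace transform of
a positive integrable density. -/
theorem exp_laplace_mul [SFinite μ] (hl : Measurable l)
    (hl0 : ∀ᵐ s ∂μ, 0 ≤ (l s).re) {k : ℝ → ℝ} (hk : Measurable k)
    (hk0 : ∀ y ∈ Ioi (0 : ℝ), 0 ≤ k y) (hki : IntegrableOn k (Ioi 0))
    (H : LaplacePos μ l h) :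
    LaplacePos μ l (fun s => Complex.exp
      (∫ y in Ioi (0 : ℝ), (k y : ℂ) * Complex.exp (-(y * l s))) * h s) := by
  set N : X → ℂ := fun s => ∫ y in Ioi (0 : ℝ), (k y : ℂ) * Complex.exp (-(y * l s)) with hN
  have hki' : IntegrableOn (fun y => k y * Real.exp (-(0 * y))) (Ioi 0) := by simpa using hki
  have hpow : ∀ n : ℕ, LaplacePos μ l (fun s => N s ^ n * h s) := by
    intro n
    induction n with
    | zero => simpa using H
    | succ n ih =>
      have := laplace_mul hl le_rfl hl0 hk hk0 hki' ih
      simpa only [pow_succ', mul_assoc] using this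
  have hsum : ∀ n : ℕ, LaplacePos μ l
      (fun s => (∑ i ∈ Finset.range n, N s ^ i / (i.factorial : ℂ)) * h s) := by
    intro n
    induction n with
    | zero => simpa using zero
    | succ n ih =>
      have h1 := (hpow n).const_mul (c := (n.factorial : ℝ)⁻¹) (by positivity)
      have h2 := ih.add hl hl0 h1
      convert h2 using 2 with s
      rw [Finset.sum_range_succ]
      push_cast
      ring
  set C : ℝ := ∫ y in Ioi (0 : ℝ), k y
  have hNC : ∀ᵐ s ∂μ, ‖N s‖ ≤ C := by
    filter_upwards [hl0] with s hs
    simpa using norm_laplace_le hk0 hki' hs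
  refine of_tendsto hl hl0 hsum (H.integrable.norm.const_mul (Real.exp C)) (fun n => ?_) ?_
  · filter_upwards [hNC] with s hs
    rw [norm_mul]
    refine mul_le_mul_of_nonneg_right ?_ (norm_nonneg _)
    calc ‖∑ i ∈ Finset.range n, N s ^ i / (i.factorial : ℂ)‖
        ≤ ∑ i ∈ Finset.range n, ‖N s ^ i / (i.factorial : ℂ)‖ := norm_sum_le _ _
      _ ≤ ∑ i ∈ Finset.range n, C ^ i / (i.factorial : ℝ) := by
        refine Finset.sum_le_sum fun i _ => ?_
        rw [norm_div, norm_pow, Complex.norm_natCast]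
        gcongr
      _ ≤ Real.exp C := Real.sum_le_exp_of_nonneg ((norm_nonneg _).trans hs) n
  · refine Eventually.of_forall fun s => Tendsto.mul_const _ ?_
    change Tendsto _ _ (𝓝 (Complex.exp (N s)))
    rw [Complex.exp_eq_exp_ℂ]
    exact (NormedSpace.expSeries_div_hasSum_exp (N s)).tendsto_sum_nat

end LaplacePos

theorem norm_one_sub_exp_neg_le {z : ℂ} (hz : 0 ≤ z.re) :
    ‖1 - Complex.exp (-z)‖ ≤ 2 * ‖z‖ ∧ ‖1 - Complex.exp (-z)‖ ≤ 2 := by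
  have h2 : ‖1 - Complex.exp (-z)‖ ≤ 2 := by
    refine (norm_sub_le _ _).trans ?_
    rw [Complex.norm_exp, norm_one]
    have : Real.exp (-z).re ≤ 1 := Real.exp_le_one_iff.2 (by simpa using hz)
    linarith
  refine ⟨?_, h2⟩
  rcases le_or_gt ‖z‖ 1 with h | h
  · have := Complex.norm_exp_sub_one_le (x := -z) (by simpa using h)
    rwa [norm_neg, norm_sub_rev] at this
  · linarith

theorem integrableOn_rpow_mul_cexp {a : ℝ} (ha : 0 < a) {z : ℂ} (hz : 0 < z.re) :
    IntegrableOn (fun y : ℝ => ((y ^ (a - 1) : ℝ) : ℂ) * Complex.exp (-(y * z))) (Ioi 0) := by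
  have hb := integrableOn_rpow_mul_exp_neg_mul_rpow (p := 1) (s := a - 1) (by linarith)
    one_pos hz
  refine hb.mono' (Measurable.aestronglyMeasurable (by fun_prop)) ?_
  filter_upwards [ae_restrict_mem measurableSet_Ioi] with y hy
  have hy' : 0 < y := hy
  rw [norm_mul, norm_real, Real.norm_of_nonneg (by positivity), Complex.norm_exp]
  simp [mul_comm]

/-- The Laplace transform of a power function on the right half plane. -/
theorem integral_rpow_mul_cexp_neg_mul {a : ℝ} (ha : 0 < a) {z : ℂ} (hz : 0 < z.re) :
    ∫ y in Ioi (0 : ℝ), ((y ^ (a - 1) : ℝ) : ℂ) * Complex.exp (-(y * z)) =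
      Real.Gamma a * z ^ (-(a : ℂ)) := by
  set U : Set ℂ := {z | 0 < z.re} with hU
  have hUo : IsOpen U := isOpen_lt continuous_const Complex.continuous_re
  have hUc : IsPreconnected U := (convex_halfSpace_re_gt 0).isPreconnected
  set J : ℂ → ℂ := fun z => ∫ y in Ioi (0 : ℝ), ((y ^ (a - 1) : ℝ) : ℂ) * Complex.exp (-(y * z))
  set K : ℂ → ℂ := fun z => Real.Gamma a * z ^ (-(a : ℂ))
  have hJ : AnalyticOnNhd ℂ J U := by
    refine DifferentiableOn.analyticOnNhd (fun w hw => ?_) hUo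
    have hw' : 0 < w.re := hw
    have hs : {z : ℂ | w.re / 2 < z.re} ∈ 𝓝 w :=
      (isOpen_lt continuous_const Complex.continuous_re).mem_nhds
        (show w.re / 2 < w.re by linarith)
    refine ((hasDerivAt_integral_of_dominated_loc_of_deriv_le (μ := volume.restrict (Ioi 0))
      (F := fun z (y : ℝ) => ((y ^ (a - 1) : ℝ) : ℂ) * Complex.exp (-(y * z)))
      (F' := fun z y => ((y ^ (a - 1) : ℝ) : ℂ) * (Complex.exp (-(y * z)) * (-(y : ℂ))))
      (bound := fun y => y ^ a * Real.exp (-(w.re / 2) * y ^ (1 : ℝ))) hs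
      (Eventually.of_forall fun z => Measurable.aestronglyMeasurable (by fun_prop))
      (integrableOn_rpow_mul_cexp ha hw') (Measurable.aestronglyMeasurable (by fun_prop)) ?_
      (integrableOn_rpow_mul_exp_neg_mul_rpow (by linarith) one_pos (by linarith)) ?_
      ).2).differentiableAt.differentiableWithinAt
    · filter_upwards [ae_restrict_mem measurableSet_Ioi] with y hy z hz
      have hy' : 0 < y := hy
      have hz' : w.re / 2 < z.re := hz
      rw [norm_mul, norm_mul, norm_real, Real.norm_of_nonneg (by positivity), Complex.norm_exp,
        norm_neg, norm_real, Real.norm_of_nonneg hy'.le, Real.rpow_one]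
      have e1 : y ^ a = y ^ (a - 1) * y := by
        rw [← Real.rpow_add_one hy'.ne']; ring_nf
      have e2 : Real.exp (-(y * z)).re ≤ Real.exp (-(w.re / 2) * y) := by
        apply Real.exp_le_exp.2
        simp only [neg_re, re_ofReal_mul]
        nlinarith
      rw [e1]
      calc y ^ (a - 1) * (Real.exp (-(y * z)).re * y)
          = y ^ (a - 1) * y * Real.exp (-(y * z)).re := by ring
        _ ≤ _ := by gcongr
    · refine Eventually.of_forall fun y z _ => ?_
      have h1 : HasDerivAt (fun z : ℂ => -(y * z)) (-(y : ℂ)) z := by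
        simpa using ((hasDerivAt_id' z).const_mul (y : ℂ)).fun_neg
      exact h1.cexp.const_mul _
  have hK : AnalyticOnNhd ℂ K U := by
    refine DifferentiableOn.analyticOnNhd (fun w hw => ?_) hUo
    have : DifferentiableAt ℂ (fun z : ℂ => z ^ (-(a : ℂ))) w :=
      differentiableAt_id.cpow_const (Or.inl hw)
    exact (this.const_mul _).differentiableWithinAt
  have heq : ∀ r : ℝ, 0 < r → J r = K r := by
    intro r hr
    have h1 := Real.integral_rpow_mul_exp_neg_mul_Ioi ha hr
    have h2 : J r = ((∫ y in Ioi (0 : ℝ), y ^ (a - 1) * Real.exp (-(r * y)) : ℝ) : ℂ) := by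
      rw [← integral_complex_ofReal]
      refine setIntegral_congr_fun measurableSet_Ioi fun y hy => ?_
      push_cast
      rw [mul_comm (r : ℂ)]
    rw [h2, h1]
    have h3 : ((r : ℝ) : ℂ) ^ (-(a : ℂ)) = ((r ^ (-a) : ℝ) : ℂ) := by
      rw [ofReal_cpow hr.le]; simp
    simp only [K, h3]
    rw [one_div, Real.inv_rpow hr.le, ← Real.rpow_neg hr.le]
    push_cast
    ring
  refine hJ.eqOn_of_preconnected_of_frequently_eq hK hUc (z₀ := 1) (by simp [hU]) ?_ hz
  have ht : Tendsto (fun n : ℕ => (((1 : ℝ) + 1 / ((n : ℝ) + 1) : ℝ) : ℂ)) atTop (𝓝[≠] 1) := by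
    refine tendsto_nhdsWithin_iff.2 ⟨?_, Eventually.of_forall fun n => ?_⟩
    · have := (tendsto_one_div_add_atTop_nhds_zero_nat (𝕜 := ℝ)).const_add 1
      rw [add_zero] at this
      exact_mod_cast (Complex.continuous_ofReal.tendsto (1 : ℝ)).comp this
    · simp only [mem_compl_iff, mem_singleton_iff]
      intro h
      have h' : (1 : ℝ) + 1 / ((n : ℝ) + 1) = 1 := by exact_mod_cast h
      have : 0 < 1 / ((n : ℝ) + 1) := by positivity
      linarith
  exact ht.frequently (Frequently.of_forall fun n => heq _ (by positivity))

theorem integrableOn_one_sub_cexp_mul_rpow {b : ℝ} (hb : b ∈ Ioo (0 : ℝ) 1) {z : ℂ}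
    (hz : 0 ≤ z.re) : IntegrableOn
      (fun y : ℝ => ((y ^ (-1 - b) : ℝ) : ℂ) * (1 - Complex.exp (-(y * z)))) (Ioi 0) := by
  have hre : ∀ y : ℝ, 0 < y → 0 ≤ ((y : ℂ) * z).re := fun y hy => by
    rw [re_ofReal_mul]; positivity
  rw [← Ioc_union_Ioi_eq_Ioi zero_le_one]
  refine IntegrableOn.union ?_ ?_
  · have h1 : IntegrableOn (fun y : ℝ => 2 * ‖z‖ * y ^ (-b)) (Ioc 0 1) := by
      refine Integrable.const_mul ?_ _
      exact (intervalIntegrable_iff_integrableOn_Ioc_of_le zero_le_one).1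
        (intervalIntegral.intervalIntegrable_rpow' (by linarith [hb.2]))
    refine h1.mono' (Measurable.aestronglyMeasurable (by fun_prop)) ?_
    filter_upwards [ae_restrict_mem measurableSet_Ioc] with y hy
    rw [norm_mul, norm_real, Real.norm_of_nonneg (Real.rpow_nonneg hy.1.le _)]
    have h2 := (norm_one_sub_exp_neg_le (hre y hy.1)).1
    rw [norm_mul, norm_real, Real.norm_of_nonneg hy.1.le] at h2
    have e1 : y ^ (-b) = y ^ (-1 - b) * y := by
      rw [← Real.rpow_add_one hy.1.ne']; ring_nf
    have h3 := Real.rpow_nonneg hy.1.le (-1 - b)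
    rw [e1]
    nlinarith
  · have h1 : IntegrableOn (fun y : ℝ => 2 * y ^ (-1 - b)) (Ioi 1) :=
      Integrable.const_mul (integrableOn_Ioi_rpow_of_lt (by linarith [hb.1]) one_pos) _
    refine h1.mono' (Measurable.aestronglyMeasurable (by fun_prop)) ?_
    filter_upwards [ae_restrict_mem measurableSet_Ioi] with y hy
    have hy0 : 0 < y := one_pos.trans hy
    rw [norm_mul, norm_real, Real.norm_of_nonneg (Real.rpow_nonneg hy0.le _)]
    have h2 := (norm_one_sub_exp_neg_le (hre y hy0)).2
    have h3 := Real.rpow_nonneg hy0.le (-1 - b)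
    nlinarith

theorem hasDerivAt_ofReal_rpow {y : ℝ} (hy : 0 < y) (p : ℝ) :
    HasDerivAt (fun y : ℝ => ((y ^ p : ℝ) : ℂ)) ((p * y ^ (p - 1) : ℝ) : ℂ) y :=
  (Real.hasDerivAt_rpow_const (Or.inl hy.ne')).ofReal_comp

/-- The Lévy–Khintchine representation of `z ^ b` for `0 < b < 1`. -/
theorem integral_one_sub_cexp_mul_rpow {b : ℝ} (hb : b ∈ Ioo (0 : ℝ) 1) {z : ℂ}
    (hz : 0 < z.re) :
    ∫ y in Ioi (0 : ℝ), ((y ^ (-1 - b) : ℝ) : ℂ) * (1 - Complex.exp (-(y * z))) =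
      (Real.Gamma (1 - b) / b : ℝ) * z ^ (b : ℂ) := by
  have hb0 : b ≠ 0 := hb.1.ne'
  have hre : ∀ y : ℝ, 0 < y → 0 ≤ ((y : ℂ) * z).re := fun y hy => by
    rw [re_ofReal_mul]; positivity
  have hG := integral_rpow_mul_cexp_neg_mul (a := 1 - b) (by linarith [hb.2]) hz
  have hI1 := integrableOn_one_sub_cexp_mul_rpow hb hz.le
  have hI2 := (integrableOn_rpow_mul_cexp (a := 1 - b) (by linarith [hb.2]) hz).const_mul (z / b)
  set f : ℝ → ℂ := fun y => ((y ^ (-b) : ℝ) : ℂ) * (1 - Complex.exp (-(y * z))) with hf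
  have hnorm : ∀ y : ℝ, 0 < y → ‖f y‖ ≤ 2 * ‖z‖ * y ^ (1 - b) ∧ ‖f y‖ ≤ 2 * y ^ (-b) := by
    intro y hy
    have h2 := norm_one_sub_exp_neg_le (hre y hy)
    rw [norm_mul (y : ℂ), norm_real, Real.norm_of_nonneg hy.le] at h2
    have h3 := Real.rpow_nonneg hy.le (-b)
    have e1 : y ^ (1 - b) = y ^ (-b) * y := by
      rw [← Real.rpow_add_one hy.ne']; ring_nf
    simp only [hf, norm_mul, norm_real, Real.norm_of_nonneg h3, e1]
    constructor <;> nlinarith [h2.1, h2.2]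
  have hf0 : f 0 = 0 := by simp [hf]
  have key := integral_Ioi_of_hasDerivAt_of_tendsto (a := (0 : ℝ)) (f := f) (m := 0)
    (f' := fun y => -(b : ℂ) * (((y ^ (-1 - b) : ℝ) : ℂ) * (1 - Complex.exp (-(y * z))))
      + (b : ℂ) * (z / b * (((y ^ (1 - b - 1) : ℝ) : ℂ) * Complex.exp (-(y * z))))) ?_ ?_
      ((hI1.const_mul _).add (hI2.const_mul _)) ?_
  · rw [integral_add (hI1.const_mul _) (hI2.const_mul _), integral_const_mul, integral_const_mul,
      integral_const_mul, hG, hf0, sub_zero] at key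
    have hbc : (b : ℂ) ≠ 0 := by exact_mod_cast hb0
    have hz0 : z ≠ 0 := fun h => by simp [h] at hz
    have e2 : z ^ (b : ℂ) = z * z ^ (-((1 - b : ℝ) : ℂ)) := by
      nth_rewrite 2 [← Complex.cpow_one z]
      rw [← Complex.cpow_add _ _ hz0]
      push_cast
      ring_nf
    rw [e2]
    generalize (∫ y in Ioi (0 : ℝ), ((y ^ (-1 - b) : ℝ) : ℂ) * (1 - Complex.exp (-(y * z)))) = A
      at key ⊢
    push_cast at key ⊢
    field_simp at key ⊢
    linear_combination -key
  · have h1 : Tendsto (fun y : ℝ => 2 * ‖z‖ * y ^ (1 - b)) (𝓝[≥] 0) (𝓝 0) := by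
      have := ((Real.continuousAt_rpow_const 0 (1 - b) (Or.inr (by linarith [hb.2]))).tendsto).const_mul
        (2 * ‖z‖)
      rw [Real.zero_rpow (by linarith [hb.2]), mul_zero] at this
      exact this.mono_left nhdsWithin_le_nhds
    rw [ContinuousWithinAt, hf0]
    refine squeeze_zero_norm' ?_ h1
    filter_upwards [self_mem_nhdsWithin] with y hy
    rcases eq_or_lt_of_le (show (0 : ℝ) ≤ y from hy) with rfl | hy'
    · rw [hf0, norm_zero, Real.zero_rpow (by linarith [hb.2]), mul_zero]
    · exact (hnorm y hy').1
  · intro y hy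
    have h1 := hasDerivAt_ofReal_rpow hy (-b)
    have h2 : HasDerivAt (fun y : ℝ => -((y : ℂ) * z)) (-z) y := by
      simpa using ((hasDerivAt_id' y).ofReal_comp.mul_const z).fun_neg
    refine (h1.mul (h2.cexp.const_sub 1)).congr_deriv ?_
    have hbc : (b : ℂ) ≠ 0 := by exact_mod_cast hb0
    rw [show -b - 1 = -1 - b by ring, show 1 - b - 1 = -b by ring]
    push_cast
    field_simp
  · have h1 : Tendsto (fun y : ℝ => 2 * y ^ (-b)) atTop (𝓝 0) := by
      simpa using (tendsto_rpow_neg_atTop hb.1).const_mul 2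
    refine squeeze_zero_norm' ?_ h1
    filter_upwards [eventually_gt_atTop 0] with y hy
    exact (hnorm y hy).2

theorem integral_cos_mul_gaussian_nonneg {ε : ℝ} (hε : 0 < ε) (c : ℝ) :
    0 ≤ ∫ s in Ioi (0 : ℝ), Real.cos (c * s) * Real.exp (-ε * s ^ 2) := by
  have h1 := integral_comp_abs (f := fun s : ℝ => Real.cos (c * s) * Real.exp (-ε * s ^ 2))
  have h2 : ∀ s : ℝ, Real.cos (c * |s|) * Real.exp (-ε * |s| ^ 2) =
      (Complex.exp (Complex.I * c * s) * Complex.exp (-(ε : ℂ) * s ^ 2)).re := by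
    intro s
    have e1 : Real.cos (c * |s|) = Real.cos (c * s) := by
      rw [← Real.cos_abs (c * s), ← Real.cos_abs (c * |s|), abs_mul, abs_mul, abs_abs]
    have e2 : Complex.exp (-(ε : ℂ) * s ^ 2) = ((Real.exp (-ε * s ^ 2) : ℝ) : ℂ) := by
      push_cast; rfl
    have e3 : Complex.I * c * s = ((c * s : ℝ) : ℂ) * Complex.I := by push_cast; ring
    rw [e1, e2, e3, sq_abs, re_mul_ofReal, Complex.exp_ofReal_mul_I_re]
  have h3 := fourierIntegral_gaussian (b := (ε : ℂ)) (by simpa using hε) (c : ℂ)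
  have hint : Integrable fun s : ℝ =>
      Complex.exp (Complex.I * c * s) * Complex.exp (-(ε : ℂ) * s ^ 2) := by
    refine (integrable_cexp_quadratic (b := (ε : ℂ)) (by simpa using hε) (Complex.I * c) 0).congr
      (Eventually.of_forall fun s => ?_)
    simp only [← Complex.exp_add]
    congr 1
    ring
  simp_rw [h2] at h1
  have h4 := integral_re hint
  simp only [RCLike.re_eq_complex_re] at h4
  rw [h4, h3] at h1
  have h5 : ((Real.pi / ε : ℂ) ^ (1 / 2 : ℂ) * Complex.exp (-(c : ℂ) ^ 2 / (4 * ε))) =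
      (((Real.pi / ε) ^ (1 / 2 : ℝ) * Real.exp (-c ^ 2 / (4 * ε)) : ℝ) : ℂ) := by
    push_cast [Complex.ofReal_cpow (show 0 ≤ Real.pi / ε by positivity)]
    rfl
  rw [h5, ofReal_re] at h1
  have : 0 ≤ (Real.pi / ε) ^ (1 / 2 : ℝ) * Real.exp (-c ^ 2 / (4 * ε)) := by positivity
  linarith

namespace LaplacePos

variable {X : Type*} [MeasurableSpace X] {μ : Measure X} {l h : X → ℂ}

theorem cpow_neg_mul [SFinite μ] (hl : Measurable l) {δ : ℝ} (hδ0 : 0 < δ)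
    (hδ : ∀ᵐ s ∂μ, δ ≤ (l s).re) {a : ℝ} (ha : 0 < a) (H : LaplacePos μ l h) :
    LaplacePos μ l (fun s => l s ^ (-(a : ℂ)) * h s) := by
  have hΓ := Real.Gamma_pos_of_pos ha
  have hki : IntegrableOn (fun y : ℝ => y ^ (a - 1) * Real.exp (-(δ * y))) (Ioi 0) := by
    simpa using integrableOn_rpow_mul_exp_neg_mul_rpow (p := 1) (s := a - 1) (by linarith)
      one_pos hδ0
  have h1 := (laplace_mul hl hδ0.le hδ (k := fun y => y ^ (a - 1)) (by fun_prop)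
    (fun y hy => Real.rpow_nonneg (le_of_lt hy) _) hki H).const_mul
    (c := (Real.Gamma a)⁻¹) (by positivity)
  have heq : ∀ᵐ s ∂μ, (((Real.Gamma a)⁻¹ : ℝ) : ℂ) *
      ((∫ y in Ioi (0 : ℝ), ((y ^ (a - 1) : ℝ) : ℂ) * Complex.exp (-(y * l s))) * h s) =
      l s ^ (-(a : ℂ)) * h s := by
    filter_upwards [hδ] with s hs
    rw [integral_rpow_mul_cexp_neg_mul ha (hδ0.trans_le hs)]
    have : ((Real.Gamma a : ℝ) : ℂ) ≠ 0 := by exact_mod_cast hΓ.ne'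
    push_cast
    field_simp
  refine ⟨h1.integrable.congr heq, fun y hy => ?_⟩
  refine (h1.nonneg y hy).trans_eq (congrArg _ (integral_congr_ae ?_))
  filter_upwards [heq] with s hs
  rw [hs]

/-- Positivity is preserved under multiplication by `exp (-t * l ^ b)` for `0 < b < 1`. -/
theorem exp_neg_cpow_mul [SFinite μ] (hl : Measurable l) (hl0 : ∀ᵐ s ∂μ, 0 < (l s).re)
    {b : ℝ} (hb : b ∈ Ioo (0 : ℝ) 1) {t : ℝ} (ht : 0 ≤ t) (H : LaplacePos μ l h) :
    LaplacePos μ l (fun s => Complex.exp (-(t * l s ^ (b : ℂ))) * h s) := by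
  have hl0' : ∀ᵐ s ∂μ, 0 ≤ (l s).re := hl0.mono fun s hs => hs.le
  have hb0 := hb.1
  have hΓ := Real.Gamma_pos_of_pos (show 0 < 1 - b by linarith [hb.2])
  set c : ℝ := t * b / Real.Gamma (1 - b) with hc
  have hc0 : 0 ≤ c := by positivity
  set η : ℕ → ℝ := fun n => 1 / ((n : ℝ) + 1) with hη
  have hη0 : ∀ n, 0 < η n := fun n => by positivity
  set k : ℕ → ℝ → ℝ := fun n => (Ioi (η n)).indicator fun y => c * y ^ (-1 - b) with hk
  have hkm : ∀ n, Measurable (k n) := fun n =>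
    Measurable.indicator (by fun_prop) measurableSet_Ioi
  have hk0 : ∀ n, ∀ y ∈ Ioi (0 : ℝ), 0 ≤ k n y := fun n y hy =>
    indicator_nonneg (fun z hz => mul_nonneg hc0
      (Real.rpow_nonneg ((hη0 n).trans hz).le _)) y
  have hki : ∀ n, IntegrableOn (k n) (Ioi 0) := fun n => by
    have : IntegrableOn (fun y : ℝ => c * y ^ (-1 - b)) (Ioi (η n)) :=
      Integrable.const_mul (integrableOn_Ioi_rpow_of_lt (by linarith) (hη0 n)) _
    exact (this.integrable_indicator measurableSet_Ioi).integrableOn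
  have hpos : ∀ n, LaplacePos μ l (fun s => (Real.exp (-∫ y in Ioi (0 : ℝ), k n y) : ℝ) *
      (Complex.exp (∫ y in Ioi (0 : ℝ), (k n y : ℂ) * Complex.exp (-(y * l s))) * h s)) :=
    fun n => (exp_laplace_mul hl hl0' (hkm n) (hk0 n) (hki n) H).const_mul (Real.exp_pos _).le
  refine of_tendsto hl hl0' hpos H.integrable.norm (fun n => ?_) ?_
  · filter_upwards [hl0'] with s hs
    have h1 := norm_laplace_le (δ := 0) (hk0 n) (by simpa using hki n) hs
    simp only [zero_mul, neg_zero, Real.exp_zero, mul_one] at h1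
    rw [norm_mul, norm_mul, norm_real, Real.norm_of_nonneg (Real.exp_pos _).le, Complex.norm_exp,
      ← mul_assoc, ← Real.exp_add]
    refine mul_le_of_le_one_left (norm_nonneg _) (Real.exp_le_one_iff.2 ?_)
    linarith [Complex.re_le_norm
      (∫ y in Ioi (0 : ℝ), (k n y : ℂ) * Complex.exp (-(y * l s)))]
  · filter_upwards [hl0] with s hs
    have hInt := integrableOn_one_sub_cexp_mul_rpow hb hs.le
    have hcov : AECover (volume.restrict (Ioi (0 : ℝ))) atTop fun n => Ioi (η n) :=
      aecover_Ioi_of_Ioi tendsto_one_div_add_atTop_nhds_zero_nat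
    have hlim := hcov.integral_tendsto_of_countably_generated hInt
    rw [integral_one_sub_cexp_mul_rpow hb hs] at hlim
    have hlim' := (((hlim.const_mul (-(c : ℂ)))).cexp).mul_const (h s)
    have e0 : -(c : ℂ) * (((Real.Gamma (1 - b) / b : ℝ) : ℂ) * l s ^ (b : ℂ)) =
        -(t * l s ^ (b : ℂ)) := by
      have : c * (Real.Gamma (1 - b) / b) = t := by rw [hc]; field_simp
      rw [← mul_assoc, neg_mul, ← ofReal_mul, this, neg_mul]
    rw [e0] at hlim'
    refine hlim'.congr fun n => ?_
    rw [← mul_assoc, ofReal_exp, ← Complex.exp_add]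
    congr 2
    have hm : Ioi (η n) ∩ Ioi 0 = Ioi (η n) :=
      inter_eq_left.2 (Ioi_subset_Ioi (hη0 n).le)
    have hm' : Ioi 0 ∩ Ioi (η n) = Ioi (η n) := by rw [inter_comm, hm]
    have hexp : IntegrableOn (fun y : ℝ => (k n y : ℂ) * Complex.exp (-(y * l s))) (Ioi 0) := by
      refine (hki n).mono' (Measurable.aestronglyMeasurable
        ((Complex.measurable_ofReal.comp (hkm n)).mul (by fun_prop))) ?_
      filter_upwards [ae_restrict_mem measurableSet_Ioi] with y hy
      rw [norm_mul, norm_real, Real.norm_of_nonneg (hk0 n y hy)]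
      have := norm_exp_neg_mul_le (le_of_lt hy) hs.le
      simp only [zero_mul, neg_zero, Real.exp_zero] at this
      exact mul_le_of_le_one_right (hk0 n y hy) this
    have hkc : Integrable (fun y => (k n y : ℂ)) (volume.restrict (Ioi 0)) := (hki n).ofReal
    rw [Measure.restrict_restrict measurableSet_Ioi, hm, ofReal_neg, ← integral_complex_ofReal,
      neg_add_eq_sub, ← integral_sub hexp hkc, ← integral_const_mul]
    have : ∀ y : ℝ, (k n y : ℂ) * Complex.exp (-(y * l s)) - (k n y : ℂ) =
        (Ioi (η n)).indicator (fun y : ℝ => -(c : ℂ) *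
          (((y ^ (-1 - b) : ℝ) : ℂ) * (1 - Complex.exp (-(y * l s))))) y := by
      intro y
      by_cases hy : y ∈ Ioi (η n)
      · simp only [hk, indicator_of_mem hy]
        push_cast
        ring
      · simp [hk, indicator_of_notMem hy]
    simp_rw [this]
    rw [setIntegral_indicator measurableSet_Ioi, hm']

end LaplacePos

/-- The inverse Laplace transform of `z ^ (2 * b - 1) * exp (-t * z ^ b)`, `0 < b < 1 / 2`,
written as an integral over the imaginary axis, is nonnegative. -/
theorem re_integral_imaginary_axis_nonneg {b t : ℝ} (hb0 : 0 < b) (hb : b < 1 / 2) (ht : 0 < t)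
    (x : ℝ) : 0 ≤ (∫ s in Ioi (0 : ℝ), (Complex.I * s) ^ (-((1 - 2 * b : ℝ) : ℂ)) *
      (Complex.exp (-(t * (Complex.I * s) ^ (b : ℂ))) * Complex.exp (x * s * Complex.I))).re := by
  set a : ℝ := 1 - 2 * b with ha
  have ha0 : 0 < a := by linarith
  set δ : ℕ → ℝ := fun n => 1 / ((n : ℝ) + 1) with hδ
  have hδ0 : ∀ n, 0 < δ n := fun n => by positivity
  have hδlim : Tendsto δ atTop (𝓝 0) := tendsto_one_div_add_atTop_nhds_zero_nat
  have hbase : ∀ n, LaplacePos (volume.restrict (Ioi (0 : ℝ)))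
      (fun s : ℝ => (δ n : ℂ) + Complex.I * s)
      (fun s : ℝ => Complex.exp (x * s * Complex.I - δ n * s ^ 2)) := by
    intro n
    have hint : ∀ c : ℝ, Integrable
        (fun s : ℝ => Complex.exp (c * s * Complex.I - δ n * s ^ 2)) := fun c => by
      refine (integrable_cexp_quadratic (b := (δ n : ℂ)) (by simpa using hδ0 n)
        (Complex.I * c) 0).congr (Eventually.of_forall fun s => ?_)
      simp only
      congr 1
      ring
    refine ⟨(hint x).integrableOn, fun y hy => ?_⟩
    have e1 : ∀ s : ℝ, Complex.exp (-(y * ((δ n : ℂ) + Complex.I * s))) *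
        Complex.exp (x * s * Complex.I - δ n * s ^ 2) = (Real.exp (-(y * δ n)) : ℝ) *
        Complex.exp ((x - y : ℝ) * s * Complex.I - δ n * s ^ 2) := by
      intro s
      push_cast
      rw [← Complex.exp_add, ← Complex.exp_add]
      congr 1
      ring
    simp_rw [e1]
    rw [integral_const_mul, re_ofReal_mul]
    refine mul_nonneg (Real.exp_pos _).le ?_
    have e2 := integral_re (hint (x - y)).integrableOn (μ := volume.restrict (Ioi (0 : ℝ)))
    simp only [RCLike.re_eq_complex_re] at e2
    rw [← e2]
    refine (integral_cos_mul_gaussian_nonneg (hδ0 n) (x - y)).trans_eq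
      (integral_congr_ae (Eventually.of_forall fun s => ?_))
    have e3 : ((x - y : ℝ) : ℂ) * s * Complex.I - δ n * s ^ 2 =
        ((-δ n * s ^ 2 : ℝ) : ℂ) + (((x - y) * s : ℝ) : ℂ) * Complex.I := by push_cast; ring
    simp only
    rw [e3, Complex.exp_add, ← ofReal_exp, re_ofReal_mul, Complex.exp_ofReal_mul_I_re, mul_comm]
  have hpos : ∀ n, 0 ≤ (∫ s in Ioi (0 : ℝ), ((δ n : ℂ) + Complex.I * s) ^ (-(a : ℂ)) *
      (Complex.exp (-(t * ((δ n : ℂ) + Complex.I * s) ^ (b : ℂ))) *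
        Complex.exp (x * s * Complex.I - δ n * s ^ 2))).re := by
    intro n
    have hm : Measurable fun s : ℝ => (δ n : ℂ) + Complex.I * s := by fun_prop
    have h1 := ((hbase n).exp_neg_cpow_mul hm (Eventually.of_forall fun s => by
      simpa using hδ0 n) ⟨hb0, by linarith⟩ ht.le).cpow_neg_mul hm (hδ0 n)
      (Eventually.of_forall fun s => by simp) ha0
    simpa using h1.nonneg 0 le_rfl
  set κ : ℝ := Real.cos (Real.pi / 2 * b) with hκ
  have hκ0 : 0 < κ := by
    apply Real.cos_pos_of_mem_Ioo
    constructor <;> nlinarith [Real.pi_pos]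
  have hlim : Tendsto (fun n => ∫ s in Ioi (0 : ℝ), ((δ n : ℂ) + Complex.I * s) ^ (-(a : ℂ)) *
      (Complex.exp (-(t * ((δ n : ℂ) + Complex.I * s) ^ (b : ℂ))) *
        Complex.exp (x * s * Complex.I - δ n * s ^ 2))) atTop
      (𝓝 (∫ s in Ioi (0 : ℝ), (Complex.I * s) ^ (-(a : ℂ)) *
      (Complex.exp (-(t * (Complex.I * s) ^ (b : ℂ))) * Complex.exp (x * s * Complex.I)))) := by
    refine tendsto_integral_of_dominated_convergence
      (fun s => s ^ (-a) * Real.exp (-(t * κ) * s ^ b)) (fun n => ?_)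
      (integrableOn_rpow_mul_exp_neg_mul_rpow (by linarith) hb0 (by positivity)) (fun n => ?_) ?_
    · exact Measurable.aestronglyMeasurable (by fun_prop)
    · filter_upwards [ae_restrict_mem measurableSet_Ioi] with s hs
      have hs' : 0 < s := hs
      set z : ℂ := (δ n : ℂ) + Complex.I * s with hz
      have hzre : z.re = δ n := by simp [hz]
      have hzim : z.im = s := by simp [hz]
      have hsz : s ≤ ‖z‖ := by
        have := Complex.abs_im_le_norm z
        rwa [hzim, abs_of_pos hs'] at this
      have hn1 : ‖z ^ (-(a : ℂ))‖ ≤ s ^ (-a) := by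
        rw [← ofReal_neg, Complex.norm_cpow_real]
        exact Real.rpow_le_rpow_of_nonpos hs' hsz (by linarith)
      have hn2 : ‖Complex.exp (-(t * z ^ (b : ℂ)))‖ ≤ Real.exp (-(t * κ) * s ^ b) := by
        rw [Complex.norm_exp]
        apply Real.exp_le_exp.2
        rw [neg_re, re_ofReal_mul, Complex.cpow_ofReal_re, neg_mul, neg_le_neg_iff, mul_assoc]
        refine mul_le_mul_of_nonneg_left ?_ ht.le
        have harg0 : 0 ≤ arg z := Complex.arg_nonneg_iff.2 (by rw [hzim]; exact hs'.le)
        have harg1 : arg z ≤ Real.pi / 2 :=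
          Complex.arg_le_pi_div_two_iff.2 (Or.inl (by rw [hzre]; exact (hδ0 n).le))
        have h1 : κ ≤ Real.cos (arg z * b) := by
          apply Real.cos_le_cos_of_nonneg_of_le_pi (by positivity) (by nlinarith [Real.pi_pos])
          gcongr
        have h2 : s ^ b ≤ ‖z‖ ^ b := Real.rpow_le_rpow hs'.le hsz hb0.le
        rw [mul_comm]
        exact mul_le_mul h2 h1 hκ0.le (by positivity)
      have hn3 : ‖Complex.exp (x * s * Complex.I - δ n * s ^ 2)‖ ≤ 1 := by
        rw [Complex.norm_exp]
        apply Real.exp_le_one_iff.2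
        have : ((x : ℂ) * s * Complex.I - δ n * s ^ 2).re = -(δ n * s ^ 2) := by
          have : (x : ℂ) * s * Complex.I - δ n * s ^ 2 =
            ((-(δ n * s ^ 2) : ℝ) : ℂ) + ((x * s : ℝ) : ℂ) * Complex.I := by push_cast; ring
          rw [this, add_re, ofReal_re, re_ofReal_mul, I_re, mul_zero, add_zero]
        rw [this]
        have := hδ0 n
        have : 0 ≤ δ n * s ^ 2 := by positivity
        linarith
      rw [norm_mul, norm_mul]
      have := mul_le_mul hn2 hn3 (norm_nonneg _) (Real.exp_pos _).le
      rw [mul_one] at this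
      exact mul_le_mul hn1 this (by positivity) (by positivity)
    · filter_upwards [ae_restrict_mem measurableSet_Ioi] with s hs
      have hs' : 0 < s := hs
      have hd : Tendsto (fun n => (δ n : ℂ)) atTop (𝓝 0) := by
        exact_mod_cast (Complex.continuous_ofReal.tendsto (0 : ℝ)).comp hδlim
      have hz : Tendsto (fun n => (δ n : ℂ) + Complex.I * s) atTop (𝓝 (Complex.I * s)) := by
        simpa using hd.add_const (Complex.I * s)
      have hslit : Complex.I * s ∈ Complex.slitPlane := Or.inr (by simpa using hs'.ne')
      have hc : ∀ p : ℂ, Tendsto (fun n => ((δ n : ℂ) + Complex.I * s) ^ p) atTop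
          (𝓝 ((Complex.I * s) ^ p)) := fun p =>
        (continuousAt_cpow_const hslit).tendsto.comp hz
      refine (hc _).mul ((((hc _).const_mul _).neg.cexp).mul (Tendsto.cexp ?_))
      simpa using (hd.mul_const ((s : ℂ) ^ 2)).const_sub (x * s * Complex.I)
  exact ge_of_tendsto ((Complex.continuous_re.tendsto _).comp hlim) (Eventually.of_forall hpos)

/-- The integrand of `∫ z ^ (2 * b - 1) * exp (-x * z - t * (e ^ (i * π) * z) ^ b) dz` along the ray
of argument `ψ`. -/
noncomputable def rayIntegrand (b t x ψ r : ℝ) : ℂ :=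
  ((r ^ (2 * b - 1) : ℝ) : ℂ) * Complex.exp (2 * b * ψ * Complex.I -
    x * r * Complex.exp (ψ * Complex.I) -
    t * ((r ^ b : ℝ) : ℂ) * Complex.exp (b * (Real.pi + ψ) * Complex.I))

theorem norm_rayExp_le {b t x ψ r : ℝ} (hb0 : 0 < b) (hb : b < 1 / 2) (ht : 0 < t) (hx : 0 < x)
    (hψ : ψ ∈ Icc (-(Real.pi / 2)) 0) (hr : 0 ≤ r) :
    ‖Complex.exp (2 * b * ψ * Complex.I - x * r * Complex.exp (ψ * Complex.I) -
      t * ((r ^ b : ℝ) : ℂ) * Complex.exp (b * (Real.pi + ψ) * Complex.I))‖ ≤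
      Real.exp (-(t * Real.cos (Real.pi * b)) * r ^ b) := by
  have hpi := Real.pi_pos
  have e1 : (b * (Real.pi + ψ) * Complex.I : ℂ) = ((b * (Real.pi + ψ) : ℝ) : ℂ) * Complex.I := by
    push_cast; ring
  have e2 : (x * r : ℂ) = ((x * r : ℝ) : ℂ) := by push_cast; ring
  have e3 : (t * ((r ^ b : ℝ) : ℂ) : ℂ) = ((t * r ^ b : ℝ) : ℂ) := by push_cast; ring
  have e4 : (2 * b * ψ * Complex.I : ℂ) = ((2 * b * ψ : ℝ) : ℂ) * Complex.I := by push_cast; ring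
  rw [Complex.norm_exp, e1, e2, e3, e4, sub_re, sub_re, re_ofReal_mul, re_ofReal_mul,
    re_ofReal_mul, exp_ofReal_mul_I_re, exp_ofReal_mul_I_re, I_re, mul_zero, Real.exp_le_exp]
  have hc1 : 0 ≤ Real.cos ψ := Real.cos_nonneg_of_neg_pi_div_two_le_of_le hψ.1 (by linarith [hψ.2])
  have hc2 : Real.cos (Real.pi * b) ≤ Real.cos (b * (Real.pi + ψ)) := by
    apply Real.cos_le_cos_of_nonneg_of_le_pi
    · nlinarith [hψ.1]
    · nlinarith
    · nlinarith [hψ.2]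
  have h1 : 0 ≤ x * r * Real.cos ψ := by positivity
  have h2 : t * r ^ b * Real.cos (Real.pi * b) ≤ t * r ^ b * Real.cos (b * (Real.pi + ψ)) :=
    mul_le_mul_of_nonneg_left hc2 (by positivity)
  linarith

theorem cos_pi_mul_pos {b : ℝ} (hb0 : 0 < b) (hb : b < 1 / 2) : 0 < Real.cos (Real.pi * b) :=
  Real.cos_pos_of_mem_Ioo ⟨by nlinarith [Real.pi_pos], by nlinarith [Real.pi_pos]⟩

theorem norm_rayIntegrand_le {b t x ψ r : ℝ} (hb0 : 0 < b) (hb : b < 1 / 2) (ht : 0 < t)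
    (hx : 0 < x) (hψ : ψ ∈ Icc (-(Real.pi / 2)) 0) (hr : 0 ≤ r) :
    ‖rayIntegrand b t x ψ r‖ ≤
      r ^ (2 * b - 1) * Real.exp (-(t * Real.cos (Real.pi * b)) * r ^ b) := by
  rw [rayIntegrand, norm_mul, norm_real, Real.norm_of_nonneg (by positivity)]
  exact mul_le_mul_of_nonneg_left (norm_rayExp_le hb0 hb ht hx hψ hr) (by positivity)

theorem integrableOn_rayIntegrand_bound {b t : ℝ} (hb0 : 0 < b) (hb : b < 1 / 2) (ht : 0 < t) :
    IntegrableOn (fun r : ℝ =>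
      r ^ (2 * b - 1) * Real.exp (-(t * Real.cos (Real.pi * b)) * r ^ b)) (Ioi 0) :=
  integrableOn_rpow_mul_exp_neg_mul_rpow (by linarith) hb0 (mul_pos ht (cos_pi_mul_pos hb0 hb))

theorem aestronglyMeasurable_rayIntegrand (b t x ψ : ℝ) :
    AEStronglyMeasurable (rayIntegrand b t x ψ) (volume.restrict (Ioi 0)) := by
  unfold rayIntegrand
  exact Measurable.aestronglyMeasurable (by fun_prop)

theorem continuousOn_integral_rayIntegrand {b t x : ℝ} (hb0 : 0 < b) (hb : b < 1 / 2) (ht : 0 < t)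
    (hx : 0 < x) :
    ContinuousOn (fun ψ => ∫ r in Ioi (0 : ℝ), rayIntegrand b t x ψ r)
      (Icc (-(Real.pi / 2)) 0) := by
  refine continuousOn_of_dominated (fun ψ _ => aestronglyMeasurable_rayIntegrand b t x ψ)
    (fun ψ hψ => ?_) (integrableOn_rayIntegrand_bound hb0 hb ht)
    (Eventually.of_forall fun r => ?_)
  · filter_upwards [ae_restrict_mem measurableSet_Ioi] with r hr
    exact norm_rayIntegrand_le hb0 hb ht hx hψ (le_of_lt hr)
  · unfold rayIntegrand
    fun_prop

/-- The factor by which differentiation in the angle multiplies `rayIntegrand`, up to `I`. -/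
noncomputable def rayFactor (b t x ψ r : ℝ) : ℂ :=
  2 * b - x * r * Complex.exp (ψ * Complex.I) -
    t * b * ((r ^ b : ℝ) : ℂ) * Complex.exp (b * (Real.pi + ψ) * Complex.I)

theorem norm_rayFactor_le {b t x ψ r : ℝ} (hb0 : 0 < b) (ht : 0 < t) (hx : 0 < x) (hr : 0 ≤ r) :
    ‖rayFactor b t x ψ r‖ ≤ 2 * b + x * r + t * b * r ^ b := by
  have e1 : (b * (Real.pi + ψ) * Complex.I : ℂ) = ((b * (Real.pi + ψ) : ℝ) : ℂ) * Complex.I := by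
    push_cast; ring
  have hrb := Real.rpow_nonneg hr b
  unfold rayFactor
  refine (norm_sub_le _ _).trans (add_le_add ((norm_sub_le _ _).trans (add_le_add ?_ ?_)) ?_)
  · simp [abs_of_pos hb0]
  · rw [norm_mul, norm_exp_ofReal_mul_I]
    simp [abs_of_pos hx, abs_of_nonneg hr]
  · rw [norm_mul, e1, norm_exp_ofReal_mul_I]
    simp [abs_of_pos ht, abs_of_pos hb0, abs_of_nonneg hrb]

theorem integrableOn_rayDeriv_bound {b t : ℝ} (x : ℝ) (hb0 : 0 < b) (hb : b < 1 / 2) (ht : 0 < t) :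
    IntegrableOn (fun r : ℝ =>
      r ^ (2 * b - 1) * Real.exp (-(t * Real.cos (Real.pi * b)) * r ^ b) *
        (2 * b + x * r + t * b * r ^ b)) (Ioi 0) := by
  have hc := mul_pos ht (cos_pi_mul_pos hb0 hb)
  have h1 := (integrableOn_rayIntegrand_bound hb0 hb ht).const_mul (2 * b)
  have h2 := (integrableOn_rpow_mul_exp_neg_mul_rpow (s := 2 * b) (by linarith) hb0 hc).const_mul x
  have h3 := (integrableOn_rpow_mul_exp_neg_mul_rpow (s := 3 * b - 1) (by linarith) hb0
    hc).const_mul (t * b)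
  refine IntegrableOn.congr_fun ((h1.add h2).add h3) (fun r (hr : 0 < r) => ?_) measurableSet_Ioi
  have e1 : r ^ (2 * b) = r ^ (2 * b - 1) * r := by
    rw [← Real.rpow_add_one hr.ne']; ring_nf
  have e2 : r ^ (3 * b - 1) = r ^ (2 * b - 1) * r ^ b := by
    rw [← Real.rpow_add hr]; ring_nf
  simp only [Pi.add_apply, e1, e2]
  ring

theorem norm_rayDeriv_le {b t x ψ r : ℝ} (hb0 : 0 < b) (hb : b < 1 / 2) (ht : 0 < t)
    (hx : 0 < x) (hψ : ψ ∈ Icc (-(Real.pi / 2)) 0) (hr : 0 ≤ r) :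
    ‖rayIntegrand b t x ψ r * rayFactor b t x ψ r‖ ≤
      r ^ (2 * b - 1) * Real.exp (-(t * Real.cos (Real.pi * b)) * r ^ b) *
        (2 * b + x * r + t * b * r ^ b) := by
  rw [norm_mul]
  gcongr
  · exact norm_rayIntegrand_le hb0 hb ht hx hψ hr
  · exact norm_rayFactor_le hb0 ht hx hr

theorem aestronglyMeasurable_rayDeriv (b t x ψ : ℝ) :
    AEStronglyMeasurable (fun r => rayIntegrand b t x ψ r * rayFactor b t x ψ r)
      (volume.restrict (Ioi 0)) := by
  refine (aestronglyMeasurable_rayIntegrand b t x ψ).mul ?_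
  unfold rayFactor
  exact Measurable.aestronglyMeasurable (by fun_prop)

theorem integral_rayDeriv_eq_zero {b t x ψ : ℝ} (hb0 : 0 < b) (hb : b < 1 / 2) (ht : 0 < t)
    (hx : 0 < x) (hψ : ψ ∈ Icc (-(Real.pi / 2)) 0) :
    ∫ r in Ioi (0 : ℝ), rayIntegrand b t x ψ r * rayFactor b t x ψ r = 0 := by
  have hc := mul_pos ht (cos_pi_mul_pos hb0 hb)
  set E : ℝ → ℂ := fun r => Complex.exp (2 * b * ψ * Complex.I -
    x * r * Complex.exp (ψ * Complex.I) -
    t * ((r ^ b : ℝ) : ℂ) * Complex.exp (b * (Real.pi + ψ) * Complex.I)) with hE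
  set f : ℝ → ℂ := fun r => ((r ^ (2 * b) : ℝ) : ℂ) * E r with hf
  have hcont : Continuous f := by
    have h1 : Continuous fun r : ℝ => r ^ (2 * b) := Real.continuous_rpow_const (by linarith)
    have h2 : Continuous fun r : ℝ => r ^ b := Real.continuous_rpow_const hb0.le
    simp only [hf, hE]
    fun_prop
  have hderiv : ∀ r ∈ Ioi (0 : ℝ),
      HasDerivAt f (rayIntegrand b t x ψ r * rayFactor b t x ψ r) r := by
    intro r (hr : 0 < r)
    have h1 := hasDerivAt_ofReal_rpow hr (2 * b)
    have h2 := hasDerivAt_ofReal_rpow hr b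
    have h3 : HasDerivAt (fun r : ℝ => (r : ℂ)) 1 r := Complex.ofRealCLM.hasDerivAt
    have h4 := (((h3.const_mul (x : ℂ)).mul_const (Complex.exp (ψ * Complex.I))).const_sub
      (2 * b * ψ * Complex.I)).sub
        ((h2.const_mul (t : ℂ)).mul_const (Complex.exp (b * (Real.pi + ψ) * Complex.I)))
    refine (h1.mul h4.cexp).congr_deriv ?_
    have e1 : r ^ (2 * b) = r ^ (2 * b - 1) * r := by
      rw [← Real.rpow_add_one hr.ne']; ring_nf
    have e2 : r ^ b = r ^ (b - 1) * r := by
      rw [← Real.rpow_add_one hr.ne']; ring_nf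
    simp only [rayIntegrand, rayFactor, Pi.sub_apply]
    generalize hW : Complex.exp (2 * b * ψ * Complex.I - x * r * Complex.exp (ψ * Complex.I) -
      t * ((r ^ b : ℝ) : ℂ) * Complex.exp (b * (Real.pi + ψ) * Complex.I)) = W
    rw [e1, e2]
    push_cast
    ring
  have hint : IntegrableOn (fun r => rayIntegrand b t x ψ r * rayFactor b t x ψ r) (Ioi 0) := by
    refine (integrableOn_rayDeriv_bound x hb0 hb ht).mono'
      (aestronglyMeasurable_rayDeriv b t x ψ) ?_
    filter_upwards [ae_restrict_mem measurableSet_Ioi] with r hr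
    exact norm_rayDeriv_le hb0 hb ht hx hψ (le_of_lt hr)
  have hfint : IntegrableOn f (Ioi 0) := by
    refine (integrableOn_rpow_mul_exp_neg_mul_rpow (s := 2 * b) (by linarith) hb0 hc).mono'
      hcont.aestronglyMeasurable ?_
    filter_upwards [ae_restrict_mem measurableSet_Ioi] with r (hr : 0 < r)
    rw [hf, norm_mul, norm_real, Real.norm_of_nonneg (by positivity)]
    exact mul_le_mul_of_nonneg_left (norm_rayExp_le hb0 hb ht hx hψ hr.le) (by positivity)
  have hlim := tendsto_zero_of_hasDerivAt_of_integrableOn_Ioi hderiv hint hfint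
  rw [integral_Ioi_of_hasDerivAt_of_tendsto hcont.continuousWithinAt hderiv hint hlim]
  simp [hf, Real.zero_rpow (show (2 * b) ≠ 0 by positivity)]

theorem hasDerivAt_integral_rayIntegrand {b t x ψ : ℝ} (hb0 : 0 < b) (hb : b < 1 / 2) (ht : 0 < t)
    (hx : 0 < x) (hψ : ψ ∈ Ioo (-(Real.pi / 2)) 0) :
    HasDerivAt (fun ψ => ∫ r in Ioi (0 : ℝ), rayIntegrand b t x ψ r) 0 ψ := by
  have key := (hasDerivAt_integral_of_dominated_loc_of_deriv_le
    (μ := volume.restrict (Ioi (0 : ℝ))) (F := fun ψ r => rayIntegrand b t x ψ r)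
    (F' := fun ψ r => Complex.I * (rayIntegrand b t x ψ r * rayFactor b t x ψ r)) (x₀ := ψ)
    (bound := fun r => r ^ (2 * b - 1) * Real.exp (-(t * Real.cos (Real.pi * b)) * r ^ b) *
        (2 * b + x * r + t * b * r ^ b)) (Ioo_mem_nhds hψ.1 hψ.2)
    (Eventually.of_forall fun ψ => aestronglyMeasurable_rayIntegrand b t x ψ)
    ((integrableOn_rayIntegrand_bound hb0 hb ht).mono'
      (aestronglyMeasurable_rayIntegrand b t x ψ) ?_)
    ((aestronglyMeasurable_rayDeriv b t x ψ).const_mul _) ?_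
    (integrableOn_rayDeriv_bound x hb0 hb ht) (Eventually.of_forall fun r ψ _ => ?_)).2
  · rwa [integral_const_mul, integral_rayDeriv_eq_zero hb0 hb ht hx (Ioo_subset_Icc_self hψ),
      mul_zero] at key
  · filter_upwards [ae_restrict_mem measurableSet_Ioi] with r hr
    exact norm_rayIntegrand_le hb0 hb ht hx (Ioo_subset_Icc_self hψ) (le_of_lt hr)
  · filter_upwards [ae_restrict_mem measurableSet_Ioi] with r hr ψ hψ
    rw [norm_mul, norm_I, one_mul]
    exact norm_rayDeriv_le hb0 hb ht hx (Ioo_subset_Icc_self hψ) (le_of_lt hr)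
  · have h3 : HasDerivAt (fun ψ : ℝ => (ψ : ℂ)) 1 ψ := Complex.ofRealCLM.hasDerivAt
    have h4 := (((h3.const_mul (2 * b : ℂ)).mul_const Complex.I).sub
      (((h3.mul_const Complex.I).cexp).const_mul (x * r : ℂ))).sub
      ((((h3.const_add (Real.pi : ℂ)).const_mul (b : ℂ)).mul_const Complex.I).cexp.const_mul
        (t * ((r ^ b : ℝ) : ℂ)))
    refine (h4.cexp.const_mul ((r ^ (2 * b - 1) : ℝ) : ℂ)).congr_deriv ?_
    simp only [rayIntegrand, rayFactor, Pi.sub_apply]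
    ring

/-- Rotation of the ray of integration by `-π / 2`. -/
theorem integral_rayIntegrand_zero {b t x : ℝ} (hb0 : 0 < b) (hb : b < 1 / 2) (ht : 0 < t)
    (hx : 0 < x) :
    ∫ r in Ioi (0 : ℝ), rayIntegrand b t x 0 r =
      ∫ r in Ioi (0 : ℝ), rayIntegrand b t x (-(Real.pi / 2)) r := by
  have h := intervalIntegral.integral_eq_sub_of_hasDerivAt_of_le
    (by linarith [Real.pi_pos] : -(Real.pi / 2) ≤ 0)
    (continuousOn_integral_rayIntegrand hb0 hb ht hx)
    (fun ψ hψ => hasDerivAt_integral_rayIntegrand hb0 hb ht hx hψ) (by simp)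
  simp only [intervalIntegral.integral_zero] at h
  exact (sub_eq_zero.1 h.symm)

theorem I_mul_ofReal_cpow {s : ℝ} (hs : 0 < s) (p : ℝ) :
    (Complex.I * s) ^ (p : ℂ) =
      ((s ^ p : ℝ) : ℂ) * Complex.exp (p * (Real.pi / 2) * Complex.I) := by
  rw [cpow_def_of_ne_zero (mul_ne_zero I_ne_zero (ofReal_ne_zero.2 hs.ne')),
    Complex.log_mul_ofReal s hs Complex.I I_ne_zero, Complex.log_I, add_mul, Complex.exp_add,
    Real.rpow_def_of_pos hs]
  push_cast
  congr 2
  ring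

/-- The signed weight
`v ^ (2 * b - 1) * Im (e ^ (2 * π * i * b) * exp (-t * e ^ (π * i * b) * v ^ b))`. -/
noncomputable def oscWeight (b t v : ℝ) : ℝ :=
  v ^ (2 * b - 1) * (Complex.exp (2 * Real.pi * b * Complex.I -
    t * ((v ^ b : ℝ) : ℂ) * Complex.exp (b * Real.pi * Complex.I))).im

theorem measurable_oscWeight (b t : ℝ) : Measurable (oscWeight b t) := by
  unfold oscWeight
  have : Measurable fun v : ℝ => Complex.exp (2 * Real.pi * b * Complex.I -
    t * ((v ^ b : ℝ) : ℂ) * Complex.exp (b * Real.pi * Complex.I)) := by fun_prop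
  exact (by fun_prop : Measurable fun v : ℝ => v ^ (2 * b - 1)).mul
    (Complex.measurable_im.comp this)

theorem abs_oscWeight_le {b t v : ℝ} (hb0 : 0 < b) (hb : b ≤ 1 / 2) (ht : 0 ≤ t) (hv : 0 ≤ v) :
    |oscWeight b t v| ≤ v ^ (2 * b - 1) := by
  have e1 : (b * Real.pi * Complex.I : ℂ) = ((b * Real.pi : ℝ) : ℂ) * Complex.I := by
    push_cast; ring
  have e3 : (t * ((v ^ b : ℝ) : ℂ) : ℂ) = ((t * v ^ b : ℝ) : ℂ) := by push_cast; ring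
  have e4 : (2 * Real.pi * b * Complex.I : ℂ) = ((2 * Real.pi * b : ℝ) : ℂ) * Complex.I := by
    push_cast; ring
  rw [oscWeight, abs_mul, abs_of_nonneg (by positivity)]
  refine mul_le_of_le_one_right (by positivity) ((Complex.abs_im_le_norm _).trans ?_)
  rw [Complex.norm_exp, e1, e3, e4, sub_re, re_ofReal_mul, re_ofReal_mul, exp_ofReal_mul_I_re,
    I_re, mul_zero, Real.exp_le_one_iff, zero_sub, neg_nonpos]
  have : 0 ≤ Real.cos (b * Real.pi) := Real.cos_nonneg_of_neg_pi_div_two_le_of_le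
    (by nlinarith [Real.pi_pos]) (by nlinarith [Real.pi_pos])
  positivity

theorem laplace_oscWeight_nonneg_of_lt {b t x : ℝ} (hb0 : 0 < b) (hb : b < 1 / 2) (ht : 0 < t)
    (hx : 0 < x) : 0 ≤ ∫ v in Ioi (0 : ℝ), Real.exp (-(x * v)) * oscWeight b t v := by
  have hpi := Real.pi_pos
  have hI0 : ∀ ψ ∈ Icc (-(Real.pi / 2)) 0, IntegrableOn (rayIntegrand b t x ψ) (Ioi 0) := by
    intro ψ hψ
    refine (integrableOn_rayIntegrand_bound hb0 hb ht).mono'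
      (aestronglyMeasurable_rayIntegrand b t x ψ) ?_
    filter_upwards [ae_restrict_mem measurableSet_Ioi] with r hr
    exact norm_rayIntegrand_le hb0 hb ht hx hψ (le_of_lt hr)
  have h1 : ∫ v in Ioi (0 : ℝ), Real.exp (-(x * v)) * oscWeight b t v =
      (∫ r in Ioi (0 : ℝ), Complex.exp (2 * Real.pi * b * Complex.I) *
        rayIntegrand b t x 0 r).im := by
    have hi := integral_im (((hI0 0 ⟨by linarith, le_rfl⟩).const_mul
      (Complex.exp (2 * Real.pi * b * Complex.I))))
    simp only [RCLike.im_eq_complex_im] at hi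
    rw [← hi]
    refine setIntegral_congr_fun measurableSet_Ioi fun v (hv : 0 < v) => ?_
    simp only [oscWeight, rayIntegrand]
    have : Complex.exp (2 * Real.pi * b * Complex.I) * (((v ^ (2 * b - 1) : ℝ) : ℂ) *
        Complex.exp (2 * b * (0 : ℝ) * Complex.I - x * v * Complex.exp ((0 : ℝ) * Complex.I) -
          t * ((v ^ b : ℝ) : ℂ) * Complex.exp (b * (Real.pi + (0 : ℝ)) * Complex.I))) =
        ((Real.exp (-(x * v)) * v ^ (2 * b - 1) : ℝ) : ℂ) *
          Complex.exp (2 * Real.pi * b * Complex.I -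
            t * ((v ^ b : ℝ) : ℂ) * Complex.exp (b * Real.pi * Complex.I)) := by
      push_cast
      rw [mul_left_comm, ← Complex.exp_add, mul_comm (Complex.exp _) (_ : ℂ),
        mul_assoc ((v ^ (2 * b - 1) : ℝ) : ℂ), ← Complex.exp_add]
      simp only [mul_zero, zero_mul, Complex.exp_zero, add_zero]
      congr 2
      ring
    rw [this, im_ofReal_mul]
    exact (mul_assoc _ _ _).symm
  rw [h1, integral_const_mul, integral_rayIntegrand_zero hb0 hb ht hx, ← integral_const_mul]
  have h2 := re_integral_imaginary_axis_nonneg hb0 hb ht x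
  have h3 : ∫ s in Ioi (0 : ℝ), (Complex.I * s) ^ (-((1 - 2 * b : ℝ) : ℂ)) *
      (Complex.exp (-(t * (Complex.I * s) ^ (b : ℂ))) * Complex.exp (x * s * Complex.I)) =
      -Complex.I * ∫ r in Ioi (0 : ℝ), Complex.exp (2 * Real.pi * b * Complex.I) *
        rayIntegrand b t x (-(Real.pi / 2)) r := by
    rw [← integral_const_mul]
    refine setIntegral_congr_fun measurableSet_Ioi fun s (hs : 0 < s) => ?_
    simp only [rayIntegrand]
    have e1 : -((1 - 2 * b : ℝ) : ℂ) = ((2 * b - 1 : ℝ) : ℂ) := by push_cast; ring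
    have e2 : -Complex.I = Complex.exp (-(Real.pi / 2) * Complex.I) := by
      rw [neg_mul, Complex.exp_neg, Complex.exp_pi_div_two_mul_I, inv_I]
    rw [e1, I_mul_ofReal_cpow hs, I_mul_ofReal_cpow hs, e2]
    have e3 : Complex.exp (((-(Real.pi / 2) : ℝ) : ℂ) * Complex.I) = -Complex.I := by
      rw [e2]; push_cast; rfl
    rw [e3]
    have e4 : (b * (Real.pi + ((-(Real.pi / 2) : ℝ) : ℂ)) * Complex.I) =
        b * (Real.pi / 2) * Complex.I := by push_cast; ring
    rw [e4, mul_left_comm _ (((s ^ (2 * b - 1) : ℝ) : ℂ)) _,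
      mul_left_comm _ (((s ^ (2 * b - 1) : ℝ) : ℂ)) _, mul_assoc, ← Complex.exp_add, ← Complex.exp_add, ← Complex.exp_add, ← Complex.exp_add]
    congr 2
    push_cast
    ring
  rw [h3] at h2
  simpa using h2

theorem laplace_oscWeight_half_nonneg {t x : ℝ} (ht : 0 < t) (hx : 0 < x) :
    0 ≤ ∫ v in Ioi (0 : ℝ), Real.exp (-(x * v)) * oscWeight (1 / 2) t v := by
  have h1 : ∫ v in Ioi (0 : ℝ), Real.exp (-(x * v)) * oscWeight (1 / 2) t v =
      ∫ u in Ioi (0 : ℝ), 2 * u * Real.exp (-x * u ^ 2) * Real.sin (t * u) := by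
    rw [← integral_comp_rpow_Ioi_of_pos (show (0 : ℝ) < 2 by norm_num)]
    refine setIntegral_congr_fun measurableSet_Ioi fun u (hu : 0 < u) => ?_
    have e1 : (u ^ (2 : ℝ)) ^ (1 / 2 : ℝ) = u := by
      rw [← Real.rpow_mul hu.le]; norm_num
    have e2 : (2 * Real.pi * ((1 / 2 : ℝ) : ℂ) * Complex.I -
        t * (u : ℂ) * Complex.exp (((1 / 2 : ℝ) : ℂ) * Real.pi * Complex.I)) =
        ((Real.pi - t * u : ℝ) : ℂ) * Complex.I := by
      have : (((1 / 2 : ℝ) : ℂ) * Real.pi * Complex.I) = Real.pi / 2 * Complex.I := by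
        push_cast; ring
      rw [this, Complex.exp_pi_div_two_mul_I]
      push_cast
      ring
    simp only [oscWeight, e1, e2, exp_ofReal_mul_I_im, Real.sin_pi_sub, smul_eq_mul]
    norm_num
    ring
  have hd : ∀ u ∈ Ioi (0 : ℝ),
      HasDerivAt (fun u => -(1 / x) * (Real.exp (-x * u ^ 2) * Real.sin (t * u)))
        (2 * u * Real.exp (-x * u ^ 2) * Real.sin (t * u) -
          t / x * (Real.cos (t * u) * Real.exp (-x * u ^ 2))) u := by
    intro u _
    have h2 := (((hasDerivAt_pow 2 u).const_mul (-x)).exp.mul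
      (((hasDerivAt_id' u).const_mul t).sin)).const_mul (-(1 / x))
    refine h2.congr_deriv ?_
    field_simp
    ring
  have hi1 : IntegrableOn (fun u => 2 * u * Real.exp (-x * u ^ 2) * Real.sin (t * u))
      (Ioi 0) := by
    refine Integrable.mono' (((integrable_mul_exp_neg_mul_sq hx).norm.const_mul 2).integrableOn)
      (Continuous.aestronglyMeasurable (by fun_prop)) (Eventually.of_forall fun u => ?_)
    rw [norm_mul, mul_assoc, norm_mul, Real.norm_ofNat]
    exact mul_le_of_le_one_right (by positivity) (Real.abs_sin_le_one _)
  have hi2 : IntegrableOn (fun u => Real.cos (t * u) * Real.exp (-x * u ^ 2)) (Ioi 0) := by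
    refine Integrable.mono' (integrable_exp_neg_mul_sq hx).integrableOn
      (Continuous.aestronglyMeasurable (by fun_prop)) (Eventually.of_forall fun u => ?_)
    rw [norm_mul, Real.norm_of_nonneg (Real.exp_pos _).le]
    exact mul_le_of_le_one_left (Real.exp_pos _).le (Real.abs_cos_le_one _)
  have hi3 : IntegrableOn (fun u => -(1 / x) * (Real.exp (-x * u ^ 2) * Real.sin (t * u)))
      (Ioi 0) := by
    refine Integrable.const_mul (Integrable.mono' (integrable_exp_neg_mul_sq hx).integrableOn
      (Continuous.aestronglyMeasurable (by fun_prop)) (Eventually.of_forall fun u => ?_)) _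
    rw [norm_mul, Real.norm_of_nonneg (Real.exp_pos _).le]
    exact mul_le_of_le_one_right (Real.exp_pos _).le (Real.abs_sin_le_one _)
  have hi4 := hi1.sub (hi2.const_mul (t / x))
  have hlim := tendsto_zero_of_hasDerivAt_of_integrableOn_Ioi hd hi4 hi3
  have h3 := integral_Ioi_of_hasDerivAt_of_tendsto
    (Continuous.continuousWithinAt (by fun_prop)) hd hi4 hlim
  rw [integral_sub hi1 (hi2.const_mul (t / x)), integral_const_mul] at h3
  simp only [mul_zero, Real.sin_zero, sub_zero] at h3
  rw [h1, sub_eq_zero.1 h3]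
  exact mul_nonneg (by positivity) (integral_cos_mul_gaussian_nonneg hx t)

theorem laplace_oscWeight_nonneg {b t x : ℝ} (hb0 : 0 < b) (hb : b ≤ 1 / 2) (ht : 0 < t)
    (hx : 0 < x) : 0 ≤ ∫ v in Ioi (0 : ℝ), Real.exp (-(x * v)) * oscWeight b t v := by
  rcases hb.lt_or_eq with h | rfl
  · exact laplace_oscWeight_nonneg_of_lt hb0 h ht hx
  · exact laplace_oscWeight_half_nonneg ht hx

theorem integrableOn_exp_neg_rpow_mul_oscWeight {b t ρ : ℝ} (hb0 : 0 < b) (hb : b ≤ 1 / 2)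
    (ht : 0 ≤ t) (hρ : 0 < ρ) {c : ℝ} (hc : 0 < c) :
    IntegrableOn (fun v => Real.exp (-(c * v ^ ρ)) * oscWeight b t v) (Ioi 0) := by
  refine (integrableOn_rpow_mul_exp_neg_mul_rpow (s := 2 * b - 1) (by linarith) hρ hc).mono'
    (Measurable.aestronglyMeasurable ?_) ?_
  · exact (by fun_prop : Measurable fun v : ℝ => Real.exp (-(c * v ^ ρ))).mul
      (measurable_oscWeight b t)
  · filter_upwards [ae_restrict_mem measurableSet_Ioi] with v hv
    rw [norm_mul, Real.norm_of_nonneg (Real.exp_pos _).le, mul_comm, neg_mul]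
    exact mul_le_mul_of_nonneg_right (abs_oscWeight_le hb0 hb ht (le_of_lt hv)) (Real.exp_pos _).le

theorem integral_exp_neg_rpow_mul_oscWeight_nonneg {b t ρ : ℝ} (hb0 : 0 < b) (hb : b ≤ 1 / 2)
    (ht : 0 < t) (hρ0 : 0 < ρ) (hρ : ρ ≤ 1) :
    0 ≤ ∫ v in Ioi (0 : ℝ), Real.exp (-(v ^ ρ)) * oscWeight b t v := by
  rcases hρ.lt_or_eq with h | rfl
  swap
  · simpa using laplace_oscWeight_nonneg hb0 hb ht one_pos
  set δ : ℕ → ℝ := fun n => 1 / ((n : ℝ) + 1) with hδ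
  have hδ0 : ∀ n, 0 < δ n := fun n => by positivity
  have hδlim : Tendsto δ atTop (𝓝 0) := tendsto_one_div_add_atTop_nhds_zero_nat
  have hδint : ∀ n, IntegrableOn (fun v => Real.exp (-(δ n * v)) * oscWeight b t v) (Ioi 0) :=
    fun n => by
      simpa using integrableOn_exp_neg_rpow_mul_oscWeight hb0 hb ht.le one_pos (hδ0 n)
  have hn : ∀ n, 0 ≤ ∫ v in Ioi (0 : ℝ),
      Real.exp (-(v ^ ρ)) * (Real.exp (-(δ n * v)) * oscWeight b t v) := by
    intro n
    have H : LaplacePos (volume.restrict (Ioi (0 : ℝ))) (fun v : ℝ => (v : ℂ))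
        (fun v => ((Real.exp (-(δ n * v)) * oscWeight b t v : ℝ) : ℂ)) := by
      refine ⟨(hδint n).ofReal, fun y hy => ?_⟩
      have e : ∀ v : ℝ, Complex.exp (-(y * (v : ℂ))) *
          ((Real.exp (-(δ n * v)) * oscWeight b t v : ℝ) : ℂ) =
          ((Real.exp (-((y + δ n) * v)) * oscWeight b t v : ℝ) : ℂ) := by
        intro v
        have : -((y + δ n) * v) = -(y * v) + -(δ n * v) := by ring
        rw [this, Real.exp_add]
        push_cast
        ring
      simp_rw [e]
      rw [integral_complex_ofReal, ofReal_re]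
      exact laplace_oscWeight_nonneg hb0 hb ht (add_pos_of_nonneg_of_pos hy (hδ0 n))
    have h2 := (LaplacePos.exp_neg_cpow_mul (t := 1) Complex.measurable_ofReal
      (by filter_upwards [ae_restrict_mem measurableSet_Ioi] with v hv using by simpa using hv)
      ⟨hρ0, h⟩ zero_le_one H).nonneg 0 le_rfl
    have e : ∫ v in Ioi (0 : ℝ), Complex.exp (-((0 : ℝ) * (v : ℂ))) *
        (Complex.exp (-((1 : ℝ) * (v : ℂ) ^ (ρ : ℂ))) *
          ((Real.exp (-(δ n * v)) * oscWeight b t v : ℝ) : ℂ)) =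
        ∫ v in Ioi (0 : ℝ), ((Real.exp (-(v ^ ρ)) *
          (Real.exp (-(δ n * v)) * oscWeight b t v) : ℝ) : ℂ) := by
      refine setIntegral_congr_fun measurableSet_Ioi fun v (hv : 0 < v) => ?_
      simp only [ofReal_zero, zero_mul, neg_zero, Complex.exp_zero, one_mul, ofReal_one,
        ← ofReal_cpow hv.le]
      push_cast
      ring
    rw [e, integral_complex_ofReal, ofReal_re] at h2
    exact h2
  refine ge_of_tendsto' (tendsto_integral_of_dominated_convergence
    (fun v => ‖Real.exp (-(v ^ ρ)) * oscWeight b t v‖) (fun n => ?_) ?_ (fun n => ?_) ?_) hn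
  · exact (Measurable.mul (by fun_prop) ((by fun_prop : Measurable fun v : ℝ =>
      Real.exp (-(δ n * v))).mul (measurable_oscWeight b t))).aestronglyMeasurable
  · simpa using (integrableOn_exp_neg_rpow_mul_oscWeight hb0 hb ht.le hρ0 one_pos).norm
  · filter_upwards [ae_restrict_mem measurableSet_Ioi] with v (hv : 0 < v)
    rw [norm_mul, norm_mul, norm_mul]
    refine mul_le_mul_of_nonneg_left (mul_le_of_le_one_left (norm_nonneg _) ?_) (norm_nonneg _)
    rw [Real.norm_of_nonneg (Real.exp_pos _).le, Real.exp_le_one_iff, neg_nonpos]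
    exact mul_nonneg (hδ0 n).le hv.le
  · refine Eventually.of_forall fun v => ?_
    have h2 : Tendsto (fun n => Real.exp (-(δ n * v))) atTop (𝓝 1) := by
      simpa using ((hδlim.mul_const v).neg).rexp
    simpa using (h2.mul_const (oscWeight b t v)).const_mul (Real.exp (-(v ^ ρ)))

theorem abs_im_exp_sub_le_one {b θ τ : ℝ} (hb0 : 0 < b) (hb : b ≤ 1 / 2) (hτ : 0 ≤ τ) :
    |(Complex.exp (θ * Complex.I - τ * Complex.exp (b * Real.pi * Complex.I))).im| ≤ 1 := by
  have e1 : (b * Real.pi * Complex.I : ℂ) = ((b * Real.pi : ℝ) : ℂ) * Complex.I := by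
    push_cast; ring
  refine (Complex.abs_im_le_norm _).trans ?_
  rw [Complex.norm_exp, e1, sub_re, re_ofReal_mul, re_ofReal_mul, exp_ofReal_mul_I_re,
    I_re, mul_zero, Real.exp_le_one_iff, zero_sub, neg_nonpos]
  have : 0 ≤ Real.cos (b * Real.pi) := Real.cos_nonneg_of_neg_pi_div_two_le_of_le
    (by nlinarith [Real.pi_pos]) (by nlinarith [Real.pi_pos])
  positivity

theorem hasDerivAt_im_exp_sub (b θ : ℝ) {f : ℝ → ℝ} {f' y : ℝ} (hf : HasDerivAt f f' y) :
    HasDerivAt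
      (fun y => (Complex.exp (θ * Complex.I - f y * Complex.exp (b * Real.pi * Complex.I))).im)
      (-f' * (Complex.exp (((θ + Real.pi * b : ℝ) : ℂ) * Complex.I -
        f y * Complex.exp (b * Real.pi * Complex.I))).im) y := by
  have h1 := ((hf.ofReal_comp.mul_const (Complex.exp (b * Real.pi * Complex.I))).const_sub
    (θ * Complex.I)).cexp
  refine (Complex.imCLM.hasFDerivAt.comp_hasDerivAt y h1).congr_deriv ?_
  have e : ((θ + Real.pi * b : ℝ) : ℂ) * Complex.I -
      f y * Complex.exp (b * Real.pi * Complex.I) =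
      (θ * Complex.I - f y * Complex.exp (b * Real.pi * Complex.I)) +
        b * Real.pi * Complex.I := by
    push_cast; ring
  rw [e, Complex.exp_add (θ * Complex.I - _), ← im_ofReal_mul, imCLM_apply]
  congr 1
  push_cast
  ring

/-- Up to a constant factor, `x ^ (-1 - α) * g_{α, ρ} (x⁻¹)` as a function of `t = x ^ α`,
where `b = ρ * α`. -/
noncomputable def tiltedIntegral (b ρ t : ℝ) : ℝ :=
  ∫ v in Ioi (0 : ℝ), Real.exp (-(v ^ ρ)) * v ^ (b - 1) *
    (Complex.exp (((Real.pi * b : ℝ) : ℂ) * Complex.I -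
      ((t * v ^ b : ℝ) : ℂ) * Complex.exp (b * Real.pi * Complex.I))).im

theorem measurable_im_exp_sub (b θ a c : ℝ) : Measurable fun v : ℝ =>
    (Complex.exp (θ * Complex.I -
      ((a * v ^ c : ℝ) : ℂ) * Complex.exp (b * Real.pi * Complex.I))).im :=
  Complex.measurable_im.comp (by fun_prop)

theorem hasDerivAt_tiltedIntegral {b ρ t : ℝ} (hb0 : 0 < b) (hb : b ≤ 1 / 2) (hρ : 0 < ρ)
    (ht : 0 < t) :
    HasDerivAt (tiltedIntegral b ρ)
      (-∫ v in Ioi (0 : ℝ), Real.exp (-(v ^ ρ)) * oscWeight b t v) t := by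
  have hmeas : ∀ t : ℝ, AEStronglyMeasurable (fun v : ℝ => Real.exp (-(v ^ ρ)) * v ^ (b - 1) *
      (Complex.exp (((Real.pi * b : ℝ) : ℂ) * Complex.I -
        ((t * v ^ b : ℝ) : ℂ) * Complex.exp (b * Real.pi * Complex.I))).im)
      (volume.restrict (Ioi 0)) := fun t =>
    ((by fun_prop : Measurable fun v : ℝ => Real.exp (-(v ^ ρ)) * v ^ (b - 1)).mul
      (measurable_im_exp_sub b (Real.pi * b) t b)).aestronglyMeasurable
  have hw : ∀ t v : ℝ, 0 < v → oscWeight b t v = v ^ (b - 1) * (v ^ b *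
      (Complex.exp (((Real.pi * b + Real.pi * b : ℝ) : ℂ) * Complex.I -
        ((t * v ^ b : ℝ) : ℂ) * Complex.exp (b * Real.pi * Complex.I))).im) := by
    intro t v hv
    rw [oscWeight, ← mul_assoc, ← Real.rpow_add hv]
    congr 2
    · ring
    · congr 1
      push_cast
      ring
  have key := (hasDerivAt_integral_of_dominated_loc_of_deriv_le
    (μ := volume.restrict (Ioi (0 : ℝ)))
    (F := fun t v => Real.exp (-(v ^ ρ)) * v ^ (b - 1) *
      (Complex.exp (((Real.pi * b : ℝ) : ℂ) * Complex.I -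
        ((t * v ^ b : ℝ) : ℂ) * Complex.exp (b * Real.pi * Complex.I))).im)
    (F' := fun t v => -(Real.exp (-(v ^ ρ)) * oscWeight b t v)) (x₀ := t)
    (bound := fun v => v ^ (2 * b - 1) * Real.exp (-(v ^ ρ))) (Ioi_mem_nhds ht)
    (Eventually.of_forall hmeas)
    (Integrable.mono' (integrableOn_rpow_mul_exp_neg_rpow (s := b - 1) (by linarith) hρ)
      (hmeas t) ?_) ?_ ?_
    (integrableOn_rpow_mul_exp_neg_rpow (s := 2 * b - 1) (by linarith) hρ) ?_).2
  · rw [integral_neg] at key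
    exact key
  · filter_upwards [ae_restrict_mem measurableSet_Ioi] with v (hv : 0 < v)
    rw [norm_mul, Real.norm_of_nonneg (by positivity), mul_comm (v ^ (b - 1))]
    exact mul_le_of_le_one_right (by positivity) (abs_im_exp_sub_le_one hb0 hb (by positivity))
  · exact (((by fun_prop : Measurable fun v : ℝ => Real.exp (-(v ^ ρ))).mul
      (measurable_oscWeight b t)).neg).aestronglyMeasurable
  · filter_upwards [ae_restrict_mem measurableSet_Ioi] with v (hv : 0 < v) s (hs : 0 < s)
    rw [norm_neg, norm_mul, Real.norm_of_nonneg (Real.exp_pos _).le, mul_comm]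
    exact mul_le_mul_of_nonneg_right (abs_oscWeight_le hb0 hb hs.le hv.le) (Real.exp_pos _).le
  · filter_upwards [ae_restrict_mem measurableSet_Ioi] with v (hv : 0 < v) s _
    refine ((hasDerivAt_im_exp_sub b (Real.pi * b)
      ((hasDerivAt_id' s).mul_const (v ^ b))).const_mul _).congr_deriv ?_
    rw [hw s v hv]
    ring

theorem antitoneOn_tiltedIntegral {b ρ : ℝ} (hb0 : 0 < b) (hb : b ≤ 1 / 2) (hρ0 : 0 < ρ)
    (hρ : ρ ≤ 1) : AntitoneOn (tiltedIntegral b ρ) (Ioi 0) := by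
  have hd : ∀ t ∈ Ioi (0 : ℝ), HasDerivAt (tiltedIntegral b ρ) _ t :=
    fun t ht => hasDerivAt_tiltedIntegral hb0 hb hρ0 ht
  refine antitoneOn_of_deriv_nonpos (convex_Ioi 0)
    (fun t ht => (hd t ht).continuousAt.continuousWithinAt) ?_ ?_
  · rw [interior_Ioi]
    exact fun t ht => (hd t ht).differentiableAt.differentiableWithinAt
  · rw [interior_Ioi]
    intro t ht
    rw [(hd t ht).deriv, neg_nonpos]
    exact integral_exp_neg_rpow_mul_oscWeight_nonneg hb0 hb ht hρ0 hρ

theorem integral_exp_neg_mul_im_exp {α b t : ℝ} (hα : 0 < α) (hb0 : 0 < b) (hb : b ≤ 1 / 2)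
    (ht : 0 ≤ t) :
    ∫ y in Ioi (0 : ℝ), Real.exp (-y) * (Complex.exp (((0 : ℝ) : ℂ) * Complex.I -
      ((t * y ^ α : ℝ) : ℂ) * Complex.exp (b * Real.pi * Complex.I))).im =
    -(t * α) * ∫ y in Ioi (0 : ℝ), Real.exp (-y) * y ^ (α - 1) *
      (Complex.exp (((Real.pi * b : ℝ) : ℂ) * Complex.I -
        ((t * y ^ α : ℝ) : ℂ) * Complex.exp (b * Real.pi * Complex.I))).im := by
  set p : ℝ → ℝ := fun y => (Complex.exp (((0 : ℝ) : ℂ) * Complex.I -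
      ((t * y ^ α : ℝ) : ℂ) * Complex.exp (b * Real.pi * Complex.I))).im with hp
  set q : ℝ → ℝ := fun y => (Complex.exp (((Real.pi * b : ℝ) : ℂ) * Complex.I -
        ((t * y ^ α : ℝ) : ℂ) * Complex.exp (b * Real.pi * Complex.I))).im with hq
  have hpc : Continuous p := by
    have h1 : Continuous fun y : ℝ => y ^ α := Real.continuous_rpow_const hα.le
    exact Complex.continuous_im.comp (by fun_prop)
  have hfi : IntegrableOn (fun y => Real.exp (-y) * p y) (Ioi 0) := by
    refine (integrableOn_rpow_mul_exp_neg_rpow (s := 0) (by norm_num) one_pos).mono'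
      (Continuous.aestronglyMeasurable (by fun_prop)) ?_
    filter_upwards [ae_restrict_mem measurableSet_Ioi] with y (hy : 0 < y)
    rw [norm_mul, Real.norm_of_nonneg (Real.exp_pos _).le, Real.rpow_zero, Real.rpow_one, one_mul]
    exact mul_le_of_le_one_right (Real.exp_pos _).le
      (abs_im_exp_sub_le_one hb0 hb (by positivity))
  have hgi : IntegrableOn (fun y => Real.exp (-y) * y ^ (α - 1) * q y) (Ioi 0) := by
    refine (integrableOn_rpow_mul_exp_neg_rpow (s := α - 1) (by linarith) one_pos).mono'
      (Measurable.aestronglyMeasurable (Measurable.mul (by fun_prop)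
        (measurable_im_exp_sub b (Real.pi * b) t α))) ?_
    filter_upwards [ae_restrict_mem measurableSet_Ioi] with y (hy : 0 < y)
    rw [norm_mul, Real.norm_of_nonneg (by positivity), Real.rpow_one, mul_comm (y ^ (α - 1))]
    exact mul_le_of_le_one_right (by positivity)
      (abs_im_exp_sub_le_one hb0 hb (by positivity))
  have hd : ∀ y ∈ Ioi (0 : ℝ), HasDerivAt (fun y => Real.exp (-y) * p y)
      (-(t * α) * (Real.exp (-y) * y ^ (α - 1) * q y) - Real.exp (-y) * p y) y := by
    intro y (hy : 0 < y)
    have h1 := hasDerivAt_im_exp_sub b 0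
      ((Real.hasDerivAt_rpow_const (p := α) (Or.inl hy.ne')).const_mul t)
    refine ((hasDerivAt_neg y).exp.mul h1).congr_deriv ?_
    simp only [hp, hq, zero_add]
    ring
  have hi := (hgi.const_mul (-(t * α))).sub hfi
  have h3 := integral_Ioi_of_hasDerivAt_of_tendsto
    (Continuous.continuousWithinAt (by fun_prop)) hd hi
    (tendsto_zero_of_hasDerivAt_of_integrableOn_Ioi hd hi hfi)
  rw [integral_sub (hgi.const_mul _) hfi, integral_const_mul] at h3
  have h0 : p 0 = 0 := by simp [hp, Real.zero_rpow hα.ne']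
  rw [h0, mul_zero, sub_zero] at h3
  exact (sub_eq_zero.1 h3).symm

theorem stableDensity_inv_eq_integral {α ρ x : ℝ} (hx : 0 < x) :
    stableDensity α ρ x⁻¹ = -(x / Real.pi) * ∫ y in Ioi (0 : ℝ), Real.exp (-y) *
      (Complex.exp (((0 : ℝ) : ℂ) * Complex.I - ((x ^ α * y ^ α : ℝ) : ℂ) *
        Complex.exp (((ρ * α : ℝ) : ℂ) * Real.pi * Complex.I))).im := by
  have hpi : (Real.pi : ℂ) ≠ 0 := ofReal_ne_zero.2 Real.pi_ne_zero
  have hx' : (x : ℂ) ≠ 0 := ofReal_ne_zero.2 hx.ne'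
  rw [stableDensity, ← integral_const_mul, ← integral_const_mul,
    ← ofReal_re (∫ y in Ioi (0 : ℝ), -(x / Real.pi) * _), ← integral_complex_ofReal]
  congr 1
  refine setIntegral_congr_fun measurableSet_Ioi fun y (hy : 0 < y) => ?_
  have e1 : ((x⁻¹ : ℝ) : ℂ) ^ (-(α : ℂ)) = ((x ^ α : ℝ) : ℂ) := by
    rw [← ofReal_neg, ← ofReal_cpow (inv_nonneg.2 hx.le), Real.inv_rpow hx.le,
      Real.rpow_neg hx.le, inv_inv]
  have e2 : (y : ℂ) ^ (α : ℂ) = ((y ^ α : ℝ) : ℂ) := (ofReal_cpow hy.le α).symm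
  set B : ℂ := Complex.exp (((0 : ℝ) : ℂ) * Complex.I - ((x ^ α * y ^ α : ℝ) : ℂ) *
        Complex.exp (((ρ * α : ℝ) : ℂ) * Real.pi * Complex.I)) with hB
  have e3 : Complex.exp (-(Complex.exp ((Real.pi * ρ * α : ℂ) * Complex.I)) * (y : ℂ) ^ (α : ℂ) *
      ((x⁻¹ : ℝ) : ℂ) ^ (-(α : ℂ))) = B := by
    have : (((ρ * α : ℝ) : ℂ) * Real.pi * Complex.I) = (Real.pi * ρ * α : ℂ) * Complex.I := by
      push_cast; ring
    rw [hB, this, e1, e2]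
    congr 1
    push_cast
    ring
  have e4 : Complex.exp (-(Complex.exp (-(Real.pi * ρ * α : ℂ) * Complex.I)) *
      (y : ℂ) ^ (α : ℂ) * ((x⁻¹ : ℝ) : ℂ) ^ (-(α : ℂ))) = (starRingEnd ℂ) B := by
    rw [← e3, e1, e2, ← Complex.exp_conj]
    simp only [map_mul, map_neg, ← Complex.exp_conj, conj_ofReal, conj_I]
    congr 4
    ring_nf
  rw [e3, e4]
  have e5 : (starRingEnd ℂ) B - B = -(2 * B.im * Complex.I) := by
    rw [← neg_sub, Complex.sub_conj]; push_cast; ring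
  rw [e5]
  push_cast
  field_simp

theorem rpow_mul_stableDensity_inv {α ρ x : ℝ} (hα : 0 < α) (hρ : 0 < ρ) (hb : ρ * α ≤ 1 / 2)
    (hx : 0 < x) :
    x ^ (-1 - α) * stableDensity α ρ x⁻¹ =
      ρ * α / Real.pi * tiltedIntegral (ρ * α) ρ (x ^ α) := by
  rw [stableDensity_inv_eq_integral hx,
    integral_exp_neg_mul_im_exp hα (mul_pos hρ hα) hb (by positivity),
    ← integral_comp_rpow_Ioi_of_pos hρ]
  have h1 : ∫ v in Ioi (0 : ℝ), (ρ * v ^ (ρ - 1)) • (Real.exp (-(v ^ ρ)) * (v ^ ρ) ^ (α - 1) *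
      (Complex.exp (((Real.pi * (ρ * α) : ℝ) : ℂ) * Complex.I -
        ((x ^ α * (v ^ ρ) ^ α : ℝ) : ℂ) *
          Complex.exp (((ρ * α : ℝ) : ℂ) * Real.pi * Complex.I))).im) =
      ρ * tiltedIntegral (ρ * α) ρ (x ^ α) := by
    rw [tiltedIntegral, ← integral_const_mul]
    refine setIntegral_congr_fun measurableSet_Ioi fun v (hv : 0 < v) => ?_
    have e1 : v ^ (ρ * α - 1) = v ^ (ρ - 1) * (v ^ ρ) ^ (α - 1) := by
      rw [← Real.rpow_mul hv.le, ← Real.rpow_add hv]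
      ring_nf
    simp only [smul_eq_mul, e1, ← Real.rpow_mul hv.le]
    ring
  rw [h1]
  have e2 : x ^ (-1 - α) * (x * x ^ α) = 1 := by
    rw [← Real.rpow_one_add' hx.le (by linarith), ← Real.rpow_add hx]
    ring_nf
    exact Real.rpow_zero x
  calc _ = x ^ (-1 - α) * (x * x ^ α) *
        (ρ * α / Real.pi * tiltedIntegral (ρ * α) ρ (x ^ α)) := by ring
    _ = _ := by rw [e2, one_mul]

/-- For `0 < ρ ≤ min(1, 1/(2α))`, the function
`x ↦ x^{-1-α} g_{α,ρ}(x⁻¹)` is decreasing on `(0,∞)`. -/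
theorem stableDensity_tilde_antitone (α ρ : ℝ) (hα : α ∈ Set.Ioo (0:ℝ) 1)
    (hρ : ρ ∈ Set.Ioc (0:ℝ) 1) (hρα : ρ ≤ 1 / (2 * α)) :
    AntitoneOn (fun x : ℝ => x ^ (-1 - α) * stableDensity α ρ x⁻¹) (Set.Ioi 0) := by
  have hα0 := hα.1
  have hb0 : 0 < ρ * α := mul_pos hρ.1 hα0
  have hb : ρ * α ≤ 1 / 2 := by
    rw [le_div_iff₀ (by positivity)] at hρα
    linarith
  intro x (hx : 0 < x) y (hy : 0 < y) hxy
  simp only [rpow_mul_stableDensity_inv hα0 hρ.1 hb hx, rpow_mul_stableDensity_inv hα0 hρ.1 hb hy]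
  exact mul_le_mul_of_nonneg_left (antitoneOn_tiltedIntegral hb0 hb hρ.1 hρ.2
    (Real.rpow_pos_of_pos hx α) (Real.rpow_pos_of_pos hy α)
    (Real.rpow_le_rpow hx.le hxy hα0.le)) (div_nonneg hb0.le Real.pi_pos.le)
end

section
/- Let α ∈ [1/3,1/2]. Then the function r ↦ r^α·Re(G_α(-r^+)) is decreasing (antitone) on (0,∞). -/
open MeasureTheory Complex Set Filter

open scoped Topology

/-! ### Integrability and the Gamma integral with a complex rate -/

theorem norm_exp_neg_mul_ofReal (z : ℂ) (y : ℝ) :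
    ‖cexp (-(z * y))‖ = Real.exp (-(z.re * y)) := by
  simp [Complex.norm_exp]

theorem integrableOn_rpow_mul_exp_neg {β b : ℝ} (hβ : 0 < β) (hb : 0 < b) :
    IntegrableOn (fun y : ℝ => y ^ (β - 1) * Real.exp (-(b * y))) (Ioi 0) := by
  have h := integrableOn_rpow_mul_exp_neg_mul_rpow (p := 1) (s := β - 1) (b := b)
    (by linarith) one_pos hb
  simpa only [Real.rpow_one, neg_mul] using h

theorem integrableOn_exp_neg {b : ℝ} (hb : 0 < b) :
    IntegrableOn (fun y : ℝ => Real.exp (-(b * y))) (Ioi 0) := by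
  simpa using integrableOn_rpow_mul_exp_neg one_pos hb

theorem integrableOn_rpow_mul_cexp_neg {β : ℝ} (hβ : 0 < β) {z : ℂ} (hz : 0 < z.re) :
    IntegrableOn (fun y : ℝ => ((y ^ (β - 1) : ℝ) : ℂ) * cexp (-(z * y))) (Ioi 0) := by
  refine (integrableOn_rpow_mul_exp_neg hβ hz).mono' (by fun_prop) ?_
  filter_upwards [ae_restrict_mem measurableSet_Ioi] with y hy
  rw [norm_mul, norm_exp_neg_mul_ofReal, Complex.norm_real,
    Real.norm_of_nonneg (Real.rpow_nonneg (le_of_lt hy) _)]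

theorem exists_mul_rpow_le {α b : ℝ} (hα : 0 < α) (hα' : α < 1) (hb : 0 < b) (c : ℝ) :
    ∃ C : ℝ, ∀ y : ℝ, 0 < y → c * y ^ α ≤ b * y + C := by
  have hlim : Tendsto (fun y : ℝ => |c| * y ^ (-(1 - α))) atTop (𝓝 (|c| * 0)) :=
    (tendsto_rpow_neg_atTop (by linarith)).const_mul _
  rw [mul_zero] at hlim
  obtain ⟨Y, hY⟩ := eventually_atTop.1 (hlim.eventually (gt_mem_nhds hb))
  set M := max Y 1
  refine ⟨|c| * M ^ α, fun y hy => ?_⟩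
  have hM : 0 < M := lt_of_lt_of_le one_pos (le_max_right _ _)
  have hcy : c * y ^ α ≤ |c| * y ^ α := by
    gcongr; exact le_abs_self c
  refine hcy.trans ?_
  rcases le_total y M with h | h
  · have : |c| * y ^ α ≤ |c| * M ^ α := by gcongr
    nlinarith
  · have h1 := hY y ((le_max_left _ _).trans h)
    have h2 : y ^ α = y ^ (-(1 - α)) * y := by
      rw [← Real.rpow_add_one hy.ne']; congr 1; ring
    have h3 : 0 ≤ |c| * M ^ α := by positivity
    rw [h2]; nlinarith

theorem integrableOn_rpow_mul_exp_rpow_sub {α β b : ℝ} (hα : 0 < α) (hα' : α < 1) (hβ : 0 < β)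
    (hb : 0 < b) (c : ℝ) :
    IntegrableOn (fun y : ℝ => y ^ (β - 1) * Real.exp (c * y ^ α - b * y)) (Ioi 0) := by
  obtain ⟨C, hC⟩ := exists_mul_rpow_le hα hα' (half_pos hb) c
  refine ((integrableOn_rpow_mul_exp_neg hβ (half_pos hb)).mul_const (Real.exp C)).mono'
    (by fun_prop) ?_
  filter_upwards [ae_restrict_mem measurableSet_Ioi] with y hy
  have hy' : 0 < y := hy
  rw [Real.norm_of_nonneg (by positivity), mul_assoc, ← Real.exp_add]
  gcongr
  linarith [hC y hy']

theorem integral_rpow_mul_cexp_neg {β : ℝ} (hβ : 0 < β) {z : ℂ} (hz : 0 < z.re) :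
    ∫ y in Ioi (0 : ℝ), ((y ^ (β - 1) : ℝ) : ℂ) * cexp (-(z * y)) =
      Real.Gamma β * z ^ (-(β : ℂ)) := by
  set U : Set ℂ := {z | 0 < z.re} with hU
  have hUo : IsOpen U := isOpen_lt continuous_const continuous_re
  have hUc : IsPreconnected U := (convex_halfSpace_re_gt 0).isPreconnected
  have hl : DifferentiableOn ℂ
      (fun z : ℂ => ∫ y in Ioi (0 : ℝ), ((y ^ (β - 1) : ℝ) : ℂ) * cexp (-(z * y))) U := by
    intro z₀ hz₀
    have hz₀' : 0 < z₀.re := hz₀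
    have hn : {z : ℂ | z₀.re / 2 < z.re} ∈ 𝓝 z₀ :=
      (isOpen_lt continuous_const continuous_re).mem_nhds (by simp [hz₀'])
    refine ((hasDerivAt_integral_of_dominated_loc_of_deriv_le (μ := volume.restrict (Ioi 0))
      (F := fun (z : ℂ) (y : ℝ) => ((y ^ (β - 1) : ℝ) : ℂ) * cexp (-(z * y)))
      (F' := fun (z : ℂ) (y : ℝ) => ((y ^ (β - 1) : ℝ) : ℂ) * (cexp (-(z * y)) * (-y)))
      (bound := fun y => y ^ (β + 1 - 1) * Real.exp (-((z₀.re / 2) * y)))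
      hn ?_ (integrableOn_rpow_mul_cexp_neg hβ hz₀') (by fun_prop) ?_
      (integrableOn_rpow_mul_exp_neg (by linarith) (by linarith))
      ?_).2).differentiableAt.differentiableWithinAt
    · exact Eventually.of_forall fun z => by fun_prop
    · filter_upwards [ae_restrict_mem measurableSet_Ioi] with y hy z hz
      have hy' : 0 < y := hy
      have hz' : z₀.re / 2 < z.re := hz
      rw [norm_mul, norm_mul, norm_exp_neg_mul_ofReal, Complex.norm_real, norm_neg,
        Complex.norm_real, Real.norm_of_nonneg (by positivity), Real.norm_of_nonneg hy'.le,
        show β + 1 - 1 = (β - 1) + 1 by ring, Real.rpow_add_one hy'.ne', mul_comm (Real.exp _),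
        ← mul_assoc]
      gcongr
    · refine Eventually.of_forall fun y z _ => ?_
      have h1 : HasDerivAt (fun z : ℂ => -(z * y)) (-(1 * (y : ℂ))) z :=
        ((hasDerivAt_id z).mul_const _).neg
      simpa using (h1.cexp.const_mul ((y ^ (β - 1) : ℝ) : ℂ))
  have hr : DifferentiableOn ℂ (fun z : ℂ => (Real.Gamma β : ℂ) * z ^ (-(β : ℂ))) U := by
    intro z₀ hz₀
    exact ((differentiableAt_id.cpow_const (Or.inl hz₀)).const_mul _).differentiableWithinAt
  have hreal : ∀ r : ℝ, 0 < r →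
      ∫ y in Ioi (0 : ℝ), ((y ^ (β - 1) : ℝ) : ℂ) * cexp (-((r : ℂ) * y)) =
      Real.Gamma β * (r : ℂ) ^ (-(β : ℂ)) := by
    intro r hr
    have h := Real.integral_rpow_mul_exp_neg_mul_Ioi hβ hr
    have h2 : (r : ℂ) ^ (-(β : ℂ)) = (((1 / r) ^ β : ℝ) : ℂ) := by
      rw [← ofReal_neg, ← ofReal_cpow hr.le, one_div, Real.inv_rpow hr.le, Real.rpow_neg hr.le]
    rw [h2, mul_comm, ← ofReal_mul, ← h, ← integral_complex_ofReal]
    congr with y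
    push_cast
    rfl
  refine (hl.analyticOnNhd hUo).eqOn_of_preconnected_of_frequently_eq
    (hr.analyticOnNhd hUo) hUc (z₀ := 1) (by simp [hU]) ?_ hz
  have hseq : Tendsto (fun n : ℕ => (((1 : ℝ) + 1 / ((n : ℝ) + 1) : ℝ) : ℂ)) atTop (𝓝[≠] 1) := by
    refine tendsto_nhdsWithin_iff.2 ⟨?_, ?_⟩
    · have := (tendsto_one_div_add_atTop_nhds_zero_nat (𝕜 := ℝ)).const_add 1
      rw [add_zero] at this
      exact (continuous_ofReal.tendsto' 1 1 (by simp)).comp this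
    · refine Eventually.of_forall fun n => ?_
      have : (0 : ℝ) < 1 / ((n : ℝ) + 1) := by positivity
      rw [mem_compl_iff, mem_singleton_iff, ofReal_eq_one]
      linarith
  exact hseq.frequently (Eventually.of_forall fun n => hreal _ (by positivity)).frequently

/-! ### The integral `∫ y ^ (β - 1) exp (-w y ^ α - z y) dy` -/

/-- The integral `∫_0^∞ y ^ (β - 1) exp (-w y ^ α - z y) dy`. -/
noncomputable def stretchedLaplace (α β : ℝ) (w z : ℂ) : ℂ :=
  ∫ y in Ioi (0 : ℝ), ((y ^ (β - 1) : ℝ) : ℂ) * (cexp (-(w * (y ^ α : ℝ))) * cexp (-(z * y)))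

theorem hasSum_stretchedLaplace {α β : ℝ} (hα : 0 < α) (hα' : α < 1) (hβ : 0 < β) (w : ℂ) {z : ℂ}
    (hz : 0 < z.re) :
    HasSum (fun k : ℕ => (-w) ^ k / (k.factorial : ℂ) *
      (Real.Gamma (β + α * k) * z ^ (-((β + α * k : ℝ) : ℂ)))) (stretchedLaplace α β w z) := by
  have hterm : ∀ k : ℕ, (-w) ^ k / (k.factorial : ℂ) *
      (Real.Gamma (β + α * k) * z ^ (-((β + α * k : ℝ) : ℂ))) =
      ∫ y in Ioi (0 : ℝ), (-w) ^ k / (k.factorial : ℂ) *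
        (((y ^ (β + α * k - 1) : ℝ) : ℂ) * cexp (-(z * y))) := fun k => by
    rw [integral_const_mul, integral_rpow_mul_cexp_neg (by positivity) hz]
  have hpow : ∀ (k : ℕ) (y : ℝ), 0 < y → y ^ (β + α * k - 1) = y ^ (β - 1) * (y ^ α) ^ k := by
    intro k y hy
    rw [← Real.rpow_natCast, ← Real.rpow_mul hy.le, ← Real.rpow_add hy]
    congr 1; ring
  have hsum : ∀ y : ℝ, HasSum (fun k : ℕ => y ^ (β - 1) *
      ((‖w‖ * y ^ α) ^ k / (k.factorial : ℝ)) * Real.exp (-(z.re * y)))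
      (y ^ (β - 1) * Real.exp (‖w‖ * y ^ α - z.re * y)) := by
    intro y
    have h := ((NormedSpace.expSeries_div_hasSum_exp (‖w‖ * y ^ α)).mul_left
      (y ^ (β - 1))).mul_right (Real.exp (-(z.re * y)))
    rwa [← Real.exp_eq_exp_ℝ, mul_assoc, ← Real.exp_add, ← sub_eq_add_neg] at h
  simp_rw [hterm]
  refine hasSum_integral_of_dominated_convergence
    (fun k y => y ^ (β - 1) * ((‖w‖ * y ^ α) ^ k / (k.factorial : ℝ)) * Real.exp (-(z.re * y)))
    (fun k => by fun_prop) (fun k => ?_) (Eventually.of_forall fun y => (hsum y).summable) ?_ ?_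
  · filter_upwards [ae_restrict_mem measurableSet_Ioi] with y hy
    have hy' : 0 < y := hy
    rw [hpow k y hy', norm_mul, norm_mul, norm_exp_neg_mul_ofReal, Complex.norm_real, norm_div,
      norm_pow, norm_neg, Complex.norm_natCast, Real.norm_of_nonneg (by positivity), mul_pow]
    apply le_of_eq; ring
  · simp_rw [fun y => (hsum y).tsum_eq]
    exact integrableOn_rpow_mul_exp_rpow_sub hα hα' hβ hz _
  · filter_upwards [ae_restrict_mem measurableSet_Ioi] with y hy
    have hy' : 0 < y := hy
    have h := ((NormedSpace.expSeries_div_hasSum_exp (-(w * (y ^ α : ℝ)))).mul_right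
      (cexp (-(z * y)))).mul_left (((y ^ (β - 1) : ℝ) : ℂ))
    rw [← Complex.exp_eq_exp_ℂ] at h
    refine h.congr_fun ?_
    intro k
    rw [hpow k y hy']
    push_cast
    rw [neg_mul_eq_neg_mul w, mul_pow]
    ring

theorem stretchedLaplace_rotate {α β : ℝ} (hα : 0 < α) (hα' : α < 1) (hβ : 0 < β) (w : ℂ) {ψ : ℝ}
    (hψ : |ψ| < Real.pi / 2) :
    stretchedLaplace α β w 1 = cexp (ψ * β * I) *
      stretchedLaplace α β (w * cexp (ψ * α * I)) (cexp (ψ * I)) := by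
  obtain ⟨h1, h2⟩ := abs_lt.1 hψ
  have hpi := Real.pi_pos
  have hre : 0 < (cexp (ψ * I)).re := by
    rw [Complex.exp_ofReal_mul_I_re]; exact Real.cos_pos_of_mem_Ioo ⟨h1, h2⟩
  have hlog : Complex.log (cexp (ψ * I)) = ψ * I := by
    rw [Complex.log_exp] <;> simp <;> linarith
  refine (hasSum_stretchedLaplace hα hα' hβ w (z := 1) (by simp)).unique ?_
  refine ((hasSum_stretchedLaplace hα hα' hβ (w * cexp (ψ * α * I)) hre).mul_left _).congr_fun ?_
  intro k
  rw [Complex.cpow_def_of_ne_zero (Complex.exp_ne_zero _), hlog, Complex.one_cpow, ← neg_mul,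
    mul_pow, ← Complex.exp_nat_mul]
  have : cexp (ψ * β * I) * (cexp (k * (ψ * α * I)) * cexp (ψ * I * -((β + α * k : ℝ) : ℂ))) =
      1 := by
    rw [← Complex.exp_add, ← Complex.exp_add, Complex.exp_eq_one_iff]
    exact ⟨0, by push_cast; ring⟩
  linear_combination (-((-w) ^ k / (k.factorial : ℂ) * Real.Gamma (β + α * k))) * this

theorem stretchedLaplace_one_eq {α : ℝ} (hα : 0 < α) (hα' : α < 1) (w : ℂ) :
    stretchedLaplace α 1 w 1 = 1 - w * α * stretchedLaplace α α w 1 := by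
  have h1 := hasSum_stretchedLaplace hα hα' one_pos w (z := 1) (by simp)
  have h2 := (hasSum_stretchedLaplace hα hα' hα w (z := 1) (by simp)).mul_left (-(w * α))
  have h3 := (hasSum_nat_add_iff' 1).2 h1
  have h4 := h3.unique (h2.congr_fun ?_)
  · simp at h4
    linear_combination h4
  · intro k
    have hG : Real.Gamma (1 + α * ((k + 1 : ℕ) : ℝ)) =
        α * ((k + 1 : ℕ) : ℝ) * Real.Gamma (α + α * k) := by
      rw [add_comm, Real.Gamma_add_one (by positivity)]
      congr 2; push_cast; ring
    have hk : ((k : ℂ) + 1) ≠ 0 := by exact_mod_cast k.succ_ne_zero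
    have hk' : ((k.factorial : ℕ) : ℂ) ≠ 0 := by exact_mod_cast k.factorial_ne_zero
    rw [hG, Nat.factorial_succ, Complex.one_cpow, Complex.one_cpow]
    push_cast
    field_simp
    ring

theorem norm_stretchedLaplace_integrand_le {α β y : ℝ} {w z : ℂ} (hw : 0 ≤ w.re) (hy : 0 < y) :
    ‖((y ^ (β - 1) : ℝ) : ℂ) * (cexp (-(w * (y ^ α : ℝ))) * cexp (-(z * y)))‖ ≤
      y ^ (β - 1) * Real.exp (-(z.re * y)) := by
  rw [norm_mul, norm_mul, norm_exp_neg_mul_ofReal, norm_exp_neg_mul_ofReal, Complex.norm_real,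
    Real.norm_of_nonneg (by positivity)]
  have h1 : Real.exp (-(w.re * y ^ α)) ≤ 1 := by
    rw [Real.exp_le_one_iff]; have : 0 ≤ w.re * y ^ α := by positivity
    linarith
  have h2 := Real.exp_nonneg (-(z.re * y))
  gcongr
  nlinarith

theorem hasDerivAt_stretchedLaplace {α β : ℝ} (hα : 0 < α) (hβ : 0 < β) {u : ℂ}
    (hu : 0 ≤ u.re) {t : ℝ} (ht : 0 < t) :
    HasDerivAt (fun t : ℝ => stretchedLaplace α β (t * u) 1)
      (-(u * stretchedLaplace α (β + α) (t * u) 1)) t := by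
  have hint : -(u * stretchedLaplace α (β + α) (t * u) 1) = ∫ y in Ioi (0 : ℝ), -u *
      (((y ^ (β + α - 1) : ℝ) : ℂ) * (cexp (-((t * u) * (y ^ α : ℝ))) *
        cexp (-(1 * (y : ℂ))))) := by
    rw [integral_const_mul, stretchedLaplace, neg_mul]
  have hre : ∀ x : ℝ, 0 < x → 0 ≤ ((x : ℂ) * u).re := fun x hx => by
    rw [Complex.re_ofReal_mul]; positivity
  rw [hint]
  refine (hasDerivAt_integral_of_dominated_loc_of_deriv_le (μ := volume.restrict (Ioi 0))
    (F := fun (t : ℝ) (y : ℝ) => ((y ^ (β - 1) : ℝ) : ℂ) *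
      (cexp (-((t * u) * (y ^ α : ℝ))) * cexp (-(1 * (y : ℂ)))))
    (F' := fun (t : ℝ) (y : ℝ) => -u * (((y ^ (β + α - 1) : ℝ) : ℂ) *
      (cexp (-((t * u) * (y ^ α : ℝ))) * cexp (-(1 * (y : ℂ))))))
    (bound := fun y => ‖u‖ * (y ^ (β + α - 1) * Real.exp (-((1 : ℂ).re * y))))
    (Ioi_mem_nhds ht) ?_ ?_ (by fun_prop) ?_
    ((integrableOn_rpow_mul_exp_neg (by linarith) (by simp)).const_mul _) ?_).2
  · exact Eventually.of_forall fun z => by fun_prop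
  · refine (integrableOn_rpow_mul_exp_neg hβ (b := (1 : ℂ).re) (by simp)).mono' (by fun_prop) ?_
    filter_upwards [ae_restrict_mem measurableSet_Ioi] with y hy
    exact norm_stretchedLaplace_integrand_le (hre t ht) hy
  · filter_upwards [ae_restrict_mem measurableSet_Ioi] with y hy x hx
    rw [norm_mul, norm_neg]
    gcongr
    exact norm_stretchedLaplace_integrand_le (hre x hx) hy
  · filter_upwards [ae_restrict_mem measurableSet_Ioi] with y hy x hx
    have hy' : 0 < y := hy
    have h1 : HasDerivAt (fun t : ℝ => -(((t : ℂ) * u) * (y ^ α : ℝ)))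
        (-((1 * u) * (y ^ α : ℝ))) x :=
      ((Complex.ofRealCLM.hasDerivAt.mul_const u).mul_const _).neg
    have h2 := (h1.cexp.mul_const (cexp (-(1 * (y : ℂ))))).const_mul ((y ^ (β - 1) : ℝ) : ℂ)
    refine h2.congr_deriv ?_
    rw [show β + α - 1 = β - 1 + α by ring, Real.rpow_add hy']
    push_cast
    ring

theorem continuousAt_stretchedLaplace_comp {α β : ℝ} (hβ : 0 < β) {X : Type*} [TopologicalSpace X]
    [FirstCountableTopology X] {f : X → ℂ} (hf : Continuous f) {x₀ : X}
    (hre : ∀ᶠ x in 𝓝 x₀, 0 ≤ (f x).re) :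
    ContinuousAt (fun x => stretchedLaplace α β (f x) 1) x₀ := by
  refine continuousAt_of_dominated
    (bound := fun y => y ^ (β - 1) * Real.exp (-((1 : ℂ).re * y)))
    (Eventually.of_forall fun x => by fun_prop) ?_
    (integrableOn_rpow_mul_exp_neg hβ (by simp)) ?_
  · filter_upwards [hre] with x hx
    filter_upwards [ae_restrict_mem measurableSet_Ioi] with y hy
    exact norm_stretchedLaplace_integrand_le hx hy
  · exact Eventually.of_forall fun y => by fun_prop

/-! ### Positivity along a ray -/

open scoped ComplexConjugate

/-- A bounded function `h` on the ray through `z`, parametrized by `v > 0`, such that the functional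
`Im (z ∫ h(v) exp (-conj z * v) dv)` is nonnegative on `h` and on all its products with the
exponentials `exp (-σ z v)`, `σ ≥ 0`. -/
structure IsRayPositive (z : ℂ) (h : ℝ → ℂ) : Prop where
  aestronglyMeasurable : AEStronglyMeasurable h (volume.restrict (Ioi 0))
  bounded : ∃ C, ∀ v, 0 < v → ‖h v‖ ≤ C
  im_nonneg : ∀ σ : ℝ, 0 ≤ σ →
    0 ≤ (z * ∫ v in Ioi (0 : ℝ), cexp (-((σ * z + conj z) * v)) * h v).im

theorem norm_ray_kernel_le {z : ℂ} (hz : 0 < z.re) {σ v : ℝ} (hσ : 0 ≤ σ) (hv : 0 < v) :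
    ‖cexp (-((σ * z + conj z) * v))‖ ≤ Real.exp (-(z.re * v)) := by
  rw [norm_exp_neg_mul_ofReal, Complex.add_re, Complex.re_ofReal_mul, Complex.conj_re,
    Real.exp_le_exp]
  have : 0 ≤ σ * z.re * v := by positivity
  nlinarith

theorem integrableOn_ray_kernel_mul {z : ℂ} (hz : 0 < z.re) {h : ℝ → ℂ} {C : ℝ}
    (hm : AEStronglyMeasurable h (volume.restrict (Ioi 0))) (hC : ∀ v, 0 < v → ‖h v‖ ≤ C)
    {σ : ℝ} (hσ : 0 ≤ σ) :
    IntegrableOn (fun v : ℝ => cexp (-((σ * z + conj z) * v)) * h v) (Ioi 0) := by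
  refine ((integrableOn_exp_neg hz).mul_const C).mono'
    (AEStronglyMeasurable.mul (by fun_prop) hm) ?_
  filter_upwards [ae_restrict_mem measurableSet_Ioi] with v hv
  rw [norm_mul]
  exact mul_le_mul (norm_ray_kernel_le hz hσ hv) (hC v hv) (norm_nonneg _) (Real.exp_nonneg _)

namespace IsRayPositive

variable {z : ℂ} {h h₁ h₂ : ℝ → ℂ}

theorem integrableOn (hz : 0 < z.re) (hh : IsRayPositive z h) {σ : ℝ} (hσ : 0 ≤ σ) :
    IntegrableOn (fun v : ℝ => cexp (-((σ * z + conj z) * v)) * h v) (Ioi 0) := by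
  obtain ⟨C, hC⟩ := hh.bounded
  exact integrableOn_ray_kernel_mul hz hh.aestronglyMeasurable hC hσ

theorem one (hz : 0 < z.re) (hz' : 0 ≤ z.im) : IsRayPositive z (fun _ => 1) where
  aestronglyMeasurable := aestronglyMeasurable_const
  bounded := ⟨1, by simp⟩
  im_nonneg σ hσ := by
    have hre : 0 < (σ * z + conj z).re := by
      rw [Complex.add_re, Complex.re_ofReal_mul, Complex.conj_re]; positivity
    have h := integral_rpow_mul_cexp_neg one_pos hre
    simp only [sub_self, Real.rpow_zero, ofReal_one, one_mul, Real.Gamma_one,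
      Complex.cpow_neg_one] at h
    simp only [mul_one, h]
    rw [← div_eq_mul_inv, Complex.div_im]
    simp only [Complex.add_re, Complex.add_im, Complex.re_ofReal_mul, Complex.im_ofReal_mul,
      Complex.conj_re, Complex.conj_im]
    rw [← sub_div]
    apply div_nonneg _ (Complex.normSq_nonneg _)
    have : 0 ≤ z.re * z.im := by positivity
    nlinarith

theorem zero : IsRayPositive z (fun _ => 0) where
  aestronglyMeasurable := aestronglyMeasurable_const
  bounded := ⟨0, by simp⟩
  im_nonneg σ hσ := by simp

theorem add (hz : 0 < z.re) (hh₁ : IsRayPositive z h₁) (hh₂ : IsRayPositive z h₂) :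
    IsRayPositive z (fun v => h₁ v + h₂ v) where
  aestronglyMeasurable := hh₁.aestronglyMeasurable.add hh₂.aestronglyMeasurable
  bounded := by
    obtain ⟨C₁, hC₁⟩ := hh₁.bounded
    obtain ⟨C₂, hC₂⟩ := hh₂.bounded
    exact ⟨C₁ + C₂, fun v hv => (norm_add_le _ _).trans (add_le_add (hC₁ v hv) (hC₂ v hv))⟩
  im_nonneg σ hσ := by
    simp_rw [mul_add]
    rw [integral_add (hh₁.integrableOn hz hσ) (hh₂.integrableOn hz hσ), mul_add, Complex.add_im]
    exact add_nonneg (hh₁.im_nonneg σ hσ) (hh₂.im_nonneg σ hσ)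

theorem const_mul {c : ℝ} (hc : 0 ≤ c) (hh : IsRayPositive z h) :
    IsRayPositive z (fun v => c * h v) where
  aestronglyMeasurable := hh.aestronglyMeasurable.const_mul _
  bounded := by
    obtain ⟨C, hC⟩ := hh.bounded
    refine ⟨c * C, fun v hv => ?_⟩
    rw [norm_mul, Complex.norm_real, Real.norm_of_nonneg hc]
    gcongr
    exact hC v hv
  im_nonneg σ hσ := by
    simp_rw [mul_left_comm _ (c : ℂ)]
    rw [integral_const_mul, mul_left_comm, Complex.im_ofReal_mul]
    exact mul_nonneg hc (hh.im_nonneg σ hσ)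

theorem sum (hz : 0 < z.re) {f : ℕ → ℝ → ℂ} (hf : ∀ k, IsRayPositive z (f k)) (n : ℕ) :
    IsRayPositive z (fun v => ∑ k ∈ Finset.range n, f k v) := by
  induction n with
  | zero => simpa using zero
  | succ n ih => simpa only [Finset.sum_range_succ] using ih.add hz (hf n)

theorem of_tendsto (hz : 0 < z.re) {f : ℕ → ℝ → ℂ} (hf : ∀ n, IsRayPositive z (f n)) {C : ℝ}
    (hC : ∀ n v, 0 < v → ‖f n v‖ ≤ C)
    (hlim : ∀ v, 0 < v → Tendsto (fun n => f n v) atTop (𝓝 (h v))) : IsRayPositive z h where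
  aestronglyMeasurable := by
    refine aestronglyMeasurable_of_tendsto_ae atTop (fun n => (hf n).aestronglyMeasurable) ?_
    filter_upwards [ae_restrict_mem measurableSet_Ioi] with v hv using hlim v hv
  bounded := ⟨C, fun v hv => le_of_tendsto (hlim v hv).norm
    (Eventually.of_forall fun n => hC n v hv)⟩
  im_nonneg σ hσ := by
    have ht : Tendsto
        (fun n => ∫ v in Ioi (0 : ℝ), cexp (-((σ * z + conj z) * v)) * f n v) atTop
        (𝓝 (∫ v in Ioi (0 : ℝ), cexp (-((σ * z + conj z) * v)) * h v)) := by
      refine tendsto_integral_of_dominated_convergence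
        (fun v => Real.exp (-(z.re * v)) * C)
        (fun n => ((hf n).integrableOn hz hσ).aestronglyMeasurable)
        ((integrableOn_exp_neg hz).mul_const C) (fun n => ?_) ?_
      · filter_upwards [ae_restrict_mem measurableSet_Ioi] with v hv
        rw [norm_mul]
        exact mul_le_mul (norm_ray_kernel_le hz hσ hv) (hC n v hv) (norm_nonneg _)
          (Real.exp_nonneg _)
      · filter_upwards [ae_restrict_mem measurableSet_Ioi] with v hv
        exact (hlim v hv).const_mul _
    exact ge_of_tendsto' ((Complex.continuous_im.tendsto _).comp (ht.const_mul z))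
      fun n => (hf n).im_nonneg σ hσ

theorem mixture_mul (hz : 0 < z.re) {S : Set ℝ} (hS : MeasurableSet S) (hS' : S ⊆ Ioi 0)
    {w : ℝ → ℝ} (hw : IntegrableOn w S) (hw' : ∀ s ∈ S, 0 ≤ w s) (hh : IsRayPositive z h) :
    IsRayPositive z (fun v => (∫ s in S, (w s : ℂ) * cexp (-((v * z) * s))) * h v) := by
  obtain ⟨C, hC⟩ := hh.bounded
  have hwm : AEStronglyMeasurable (fun p : ℝ × ℝ => (w p.2 : ℂ))
      ((volume.restrict (Ioi 0)).prod (volume.restrict S)) :=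
    (Complex.continuous_ofReal.comp_aestronglyMeasurable hw.aestronglyMeasurable).comp_snd
  refine ⟨?_, ⟨(∫ s in S, w s) * C, fun v hv => ?_⟩, fun σ hσ => ?_⟩
  · refine AEStronglyMeasurable.mul ?_ hh.aestronglyMeasurable
    exact AEStronglyMeasurable.integral_prod_right'
      (f := fun p : ℝ × ℝ => (w p.2 : ℂ) * cexp (-((p.1 * z) * p.2)))
      (hwm.mul (by fun_prop))
  · rw [norm_mul]
    refine mul_le_mul ?_ (hC v hv) (norm_nonneg _) (setIntegral_nonneg hS hw')
    refine norm_integral_le_of_norm_le hw ?_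
    filter_upwards [ae_restrict_mem hS] with s hs
    have hs' : 0 < s := hS' hs
    rw [norm_mul, norm_exp_neg_mul_ofReal, Complex.norm_real, Real.norm_of_nonneg (hw' s hs),
      Complex.re_ofReal_mul]
    refine mul_le_of_le_one_right (hw' s hs) ?_
    rw [Real.exp_le_one_iff, neg_nonpos]
    have hv' : 0 < v := hv
    positivity
  · have hprod : Integrable (Function.uncurry fun v s : ℝ =>
        (w s : ℂ) * (cexp (-(((σ + s : ℝ) * z + conj z) * v)) * h v))
        ((volume.restrict (Ioi 0)).prod (volume.restrict S)) := by
      refine (((integrableOn_exp_neg hz).mul_const C).mul_prod hw).mono' ?_ ?_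
      · exact hwm.mul (AEStronglyMeasurable.mul (by fun_prop) hh.aestronglyMeasurable.comp_fst)
      · rw [Measure.prod_restrict]
        filter_upwards [ae_restrict_mem (measurableSet_Ioi.prod hS)] with p hp
        have hv : 0 < p.1 := hp.1
        have hs : 0 < p.2 := hS' hp.2
        simp only [Function.uncurry]
        rw [norm_mul, norm_mul, Complex.norm_real, Real.norm_of_nonneg (hw' _ hp.2), mul_comm]
        refine mul_le_mul_of_nonneg_right ?_ (hw' _ hp.2)
        exact mul_le_mul (norm_ray_kernel_le hz (by positivity) hv) (hC _ hv) (norm_nonneg _)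
          (Real.exp_nonneg _)
    have heq : ∫ v in Ioi (0 : ℝ), cexp (-((σ * z + conj z) * v)) *
        ((∫ s in S, (w s : ℂ) * cexp (-((v * z) * s))) * h v) =
        ∫ s in S, (w s : ℂ) *
          ∫ v in Ioi (0 : ℝ), cexp (-(((σ + s : ℝ) * z + conj z) * v)) * h v := by
      simp_rw [← integral_const_mul]
      rw [← integral_integral_swap hprod]
      refine integral_congr_ae (Eventually.of_forall fun v => ?_)
      simp only
      rw [mul_left_comm, ← integral_mul_const]
      refine integral_congr_ae (Eventually.of_forall fun s => ?_)
      simp only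
      rw [show -(((σ + s : ℝ) * z + conj z) * (v : ℂ)) =
        -((σ * z + conj z) * v) + -((v * z) * s) by push_cast; ring, Complex.exp_add]
      ring
    have hint : IntegrableOn (fun s => z * ((w s : ℂ) *
          ∫ v in Ioi (0 : ℝ), cexp (-(((σ + s : ℝ) * z + conj z) * v)) * h v)) S := by
      have := hprod.integral_prod_right
      simp only [Function.uncurry, integral_const_mul] at this
      exact this.const_mul z
    rw [heq, ← integral_const_mul, ← RCLike.im_to_complex, ← integral_im hint]
    refine setIntegral_nonneg hS fun s hs => ?_
    have hs' : 0 < s := hS' hs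
    rw [mul_left_comm, RCLike.im_to_complex, Complex.im_ofReal_mul]
    exact mul_nonneg (hw' s hs) (hh.im_nonneg _ (by positivity))

theorem cexp_mul (hz : 0 < z.re) {g : ℝ → ℂ} {B : ℝ} (hB : ∀ v, 0 < v → ‖g v‖ ≤ B)
    (hg : ∀ f, IsRayPositive z f → IsRayPositive z (fun v => g v * f v))
    (hh : IsRayPositive z h) : IsRayPositive z (fun v => cexp (g v) * h v) := by
  obtain ⟨C, hC⟩ := hh.bounded
  have hpow : ∀ k : ℕ, IsRayPositive z (fun v => g v ^ k * h v) := by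
    intro k
    induction k with
    | zero => simpa using hh
    | succ k ih => simpa only [pow_succ', mul_assoc] using hg _ ih
  have hterm : ∀ k : ℕ, IsRayPositive z (fun v => (((k.factorial : ℝ)⁻¹ : ℝ) : ℂ) *
      (g v ^ k * h v)) := fun k => (hpow k).const_mul (by positivity)
  have hs : ∀ v, HasSum (fun k : ℕ => (((k.factorial : ℝ)⁻¹ : ℝ) : ℂ) * (g v ^ k * h v))
      (cexp (g v) * h v) := by
    intro v
    have := (NormedSpace.expSeries_div_hasSum_exp (g v)).mul_right (h v)
    rw [← Complex.exp_eq_exp_ℂ] at this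
    refine this.congr_fun fun k => ?_
    push_cast
    ring
  refine of_tendsto hz (fun n => sum hz hterm n) (C := Real.exp B * C) (fun n v hv => ?_)
    (fun v _ => (hs v).tendsto_sum_nat)
  have hB0 : 0 ≤ B := (norm_nonneg _).trans (hB v hv)
  have hC0 : 0 ≤ C := (norm_nonneg _).trans (hC v hv)
  calc ‖∑ k ∈ Finset.range n, (((k.factorial : ℝ)⁻¹ : ℝ) : ℂ) * (g v ^ k * h v)‖
      ≤ ∑ k ∈ Finset.range n, B ^ k / (k.factorial : ℝ) * C := by
        refine norm_sum_le_of_le _ fun k _ => ?_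
        rw [norm_mul, norm_mul, norm_pow, Complex.norm_real, Real.norm_of_nonneg (by positivity),
          div_eq_inv_mul, mul_assoc]
        gcongr
        · exact hB v hv
        · exact hC v hv
    _ ≤ Real.exp B * C := by
        rw [← Finset.sum_mul]
        gcongr
        exact Real.sum_le_exp_of_nonneg hB0 n

end IsRayPositive

/-! ### Subordination: `exp (-t λ ^ α)` as a limit of exponentials of positive mixtures -/

theorem mul_integral_Ioi_rpow_mul_cexp {α ε : ℝ} (hα : 0 < α) (hα' : α < 1) (hε : 0 < ε) {l : ℂ}
    (hl : 0 < l.re) :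
    α * ∫ s in Ioi ε, ((s ^ (-1 - α) : ℝ) : ℂ) * cexp (-(l * s)) =
      ((ε ^ (-α) : ℝ) : ℂ) * cexp (-(l * ε)) -
        l * ∫ s in Ioi ε, ((s ^ (-α) : ℝ) : ℂ) * cexp (-(l * s)) := by
  have hi₁ : IntegrableOn (fun s : ℝ => ((s ^ (-1 - α) : ℝ) : ℂ) * cexp (-(l * s))) (Ioi ε) := by
    refine (integrableOn_Ioi_rpow_of_lt (a := -1 - α) (by linarith) hε).mono' (by fun_prop) ?_
    filter_upwards [ae_restrict_mem measurableSet_Ioi] with s hs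
    have hs' : 0 < s := hε.trans hs
    rw [norm_mul, norm_exp_neg_mul_ofReal, Complex.norm_real, Real.norm_of_nonneg (by positivity)]
    refine mul_le_of_le_one_right (by positivity) ?_
    rw [Real.exp_le_one_iff, neg_nonpos]
    positivity
  have hi₂ : IntegrableOn (fun s : ℝ => ((s ^ (-α) : ℝ) : ℂ) * cexp (-(l * s))) (Ioi ε) := by
    have := integrableOn_rpow_mul_cexp_neg (β := 1 - α) (by linarith) hl
    rw [show 1 - α - 1 = -α by ring] at this
    exact this.mono_set (Ioi_subset_Ioi hε.le)
  have hlim : Tendsto (fun s : ℝ => -(((s ^ (-α) : ℝ) : ℂ) * cexp (-(l * s)))) atTop (𝓝 0) := by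
    rw [tendsto_zero_iff_norm_tendsto_zero]
    refine squeeze_zero' (Eventually.of_forall fun _ => norm_nonneg _) ?_
      (tendsto_rpow_neg_atTop hα)
    filter_upwards [eventually_gt_atTop 0] with s hs
    rw [norm_neg, norm_mul, norm_exp_neg_mul_ofReal, Complex.norm_real,
      Real.norm_of_nonneg (by positivity)]
    refine mul_le_of_le_one_right (by positivity) ?_
    rw [Real.exp_le_one_iff, neg_nonpos]
    positivity
  have hderiv : ∀ s ∈ Ici ε, HasDerivAt (fun s : ℝ => -(((s ^ (-α) : ℝ) : ℂ) * cexp (-(l * s))))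
      (α * (((s ^ (-1 - α) : ℝ) : ℂ) * cexp (-(l * s))) +
        l * (((s ^ (-α) : ℝ) : ℂ) * cexp (-(l * s)))) s := by
    intro s hs
    have hs' : 0 < s := hε.trans_le hs
    have h1 : HasDerivAt (fun s : ℝ => ((s ^ (-α) : ℝ) : ℂ)) ((-α * s ^ (-α - 1) : ℝ) : ℂ) s :=
      (Real.hasDerivAt_rpow_const (Or.inl hs'.ne')).ofReal_comp
    have h2 : HasDerivAt (fun s : ℝ => -(l * (s : ℂ))) (-(l * 1)) s :=
      (Complex.ofRealCLM.hasDerivAt.const_mul l).neg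
    refine (h1.mul h2.cexp).neg.congr_deriv ?_
    rw [show -α - 1 = -1 - α by ring]
    push_cast
    ring
  have h := integral_Ioi_of_hasDerivAt_of_tendsto' hderiv
    ((hi₁.const_mul (α : ℂ)).add (hi₂.const_mul l)) hlim
  rw [integral_add (hi₁.const_mul (α : ℂ)) (hi₂.const_mul l), integral_const_mul,
    integral_const_mul] at h
  linear_combination h

theorem tendsto_truncated_bernstein {α : ℝ} (hα : 0 < α) (hα' : α < 1) {l : ℂ} (hl : 0 < l.re) :
    Tendsto (fun ε : ℝ => α * (∫ s in Ioi ε, ((s ^ (-1 - α) : ℝ) : ℂ) * cexp (-(l * s))) -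
      ((ε ^ (-α) : ℝ) : ℂ)) (𝓝[>] 0) (𝓝 (-(Real.Gamma (1 - α) * l ^ (α : ℂ)))) := by
  have hl0 : l ≠ 0 := fun h => by simp [h] at hl
  have hG := integral_rpow_mul_cexp_neg (β := 1 - α) (by linarith) hl
  have hi := integrableOn_rpow_mul_cexp_neg (β := 1 - α) (by linarith) hl
  rw [show 1 - α - 1 = -α by ring] at hG hi
  have hid : Tendsto (fun ε : ℝ => ε) (𝓝[>] 0) (𝓝 0) :=
    tendsto_nhdsWithin_of_tendsto_nhds tendsto_id
  have h1 : Tendsto (fun ε : ℝ => ∫ s in Ioi ε, ((s ^ (-α) : ℝ) : ℂ) * cexp (-(l * s))) (𝓝[>] 0)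
      (𝓝 (Real.Gamma (1 - α) * l ^ (-((1 - α : ℝ) : ℂ)))) := by
    rw [← hG]
    have hc := (aecover_Ioi_of_Ioi (μ := volume) (A := (0 : ℝ))
      hid).integral_tendsto_of_countably_generated hi
    refine hc.congr' ?_
    filter_upwards [self_mem_nhdsWithin] with ε hε
    rw [Measure.restrict_restrict measurableSet_Ioi,
      inter_eq_left.2 (Ioi_subset_Ioi (le_of_lt hε))]
  have h2 : Tendsto (fun ε : ℝ => ((ε ^ (-α) : ℝ) : ℂ) * (cexp (-(l * ε)) - 1)) (𝓝[>] 0) (𝓝 0) := by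
    have hd : HasDerivAt (fun ε : ℝ => cexp (-(l * ε))) (-l) 0 := by
      have h2 : HasDerivAt (fun s : ℝ => -(l * (s : ℂ))) (-(l * 1)) 0 :=
        (Complex.ofRealCLM.hasDerivAt.const_mul l).neg
      simpa using h2.cexp
    have hs := (hd.tendsto_slope_zero_right)
    have hp : Tendsto (fun ε : ℝ => ((ε ^ (1 - α) : ℝ) : ℂ)) (𝓝[>] 0) (𝓝 0) := by
      have : Tendsto (fun ε : ℝ => ε ^ (1 - α)) (𝓝[>] 0) (𝓝 (0 ^ (1 - α))) :=
        hid.rpow_const (Or.inr (by linarith))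
      rw [Real.zero_rpow (by linarith)] at this
      exact (Complex.continuous_ofReal.tendsto' 0 0 (by simp)).comp this
    have := hp.mul hs
    rw [zero_mul] at this
    refine this.congr' ?_
    filter_upwards [self_mem_nhdsWithin] with ε hε
    have hε' : 0 < ε := hε
    have hpow : ε ^ (1 - α) = ε ^ (-α) * ε := by
      rw [← Real.rpow_add_one hε'.ne']; congr 1; ring
    have hεc : (ε : ℂ) ≠ 0 := by exact_mod_cast hε'.ne'
    simp only [zero_add, ofReal_zero, mul_zero, neg_zero, Complex.exp_zero, Complex.real_smul]
    rw [hpow]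
    push_cast
    field_simp
  have h3 := h2.sub (h1.const_mul l)
  have hval : (0 : ℂ) - l * (Real.Gamma (1 - α) * l ^ (-((1 - α : ℝ) : ℂ))) =
      -(Real.Gamma (1 - α) * l ^ (α : ℂ)) := by
    have : l ^ (α : ℂ) = l * l ^ (-((1 - α : ℝ) : ℂ)) := by
      nth_rewrite 2 [← Complex.cpow_one l]
      rw [← Complex.cpow_add _ _ hl0]
      congr 1; push_cast; ring
    rw [this]; ring
  rw [hval] at h3
  refine h3.congr' ?_
  filter_upwards [self_mem_nhdsWithin] with ε hε
  rw [mul_integral_Ioi_rpow_mul_cexp hα hα' hε hl]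
  ring

theorem re_ofReal_mul_pos {z : ℂ} (hz : 0 < z.re) {v : ℝ} (hv : 0 < v) : 0 < ((v : ℂ) * z).re := by
  rw [Complex.re_ofReal_mul]; positivity

theorem norm_integral_Ioi_rpow_mul_cexp_le {α ε : ℝ} (hα : 0 < α) (hε : 0 < ε) {l : ℂ}
    (hl : 0 < l.re) :
    ‖∫ s in Ioi ε, ((s ^ (-1 - α) : ℝ) : ℂ) * cexp (-(l * s))‖ ≤ ε ^ (-α) / α := by
  have hint := integral_Ioi_rpow_of_lt (a := -1 - α) (by linarith) hε
  rw [show -1 - α + 1 = -α by ring, neg_div_neg_eq] at hint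
  rw [← hint]
  refine norm_integral_le_of_norm_le (integrableOn_Ioi_rpow_of_lt (by linarith) hε) ?_
  filter_upwards [ae_restrict_mem measurableSet_Ioi] with s hs
  have hs' : 0 < s := hε.trans hs
  rw [norm_mul, norm_exp_neg_mul_ofReal, Complex.norm_real, Real.norm_of_nonneg (by positivity)]
  refine mul_le_of_le_one_right (by positivity) ?_
  rw [Real.exp_le_one_iff, neg_nonpos]
  positivity

theorem isRayPositive_cexp_neg_cpow {α t : ℝ} (hα : 0 < α) (hα' : α < 1) (ht : 0 < t) {z : ℂ}
    (hz : 0 < z.re) (hz' : 0 ≤ z.im) :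
    IsRayPositive z (fun v => cexp (-(t * ((v : ℂ) * z) ^ (α : ℂ)))) := by
  have hG : 0 < Real.Gamma (1 - α) := Real.Gamma_pos_of_pos (by linarith)
  set c : ℝ := t / Real.Gamma (1 - α) with hc
  have hc0 : 0 < c := by positivity
  set g : ℝ → ℝ → ℂ := fun ε v => ((c * α : ℝ) : ℂ) *
    ∫ s in Ioi ε, ((s ^ (-1 - α) : ℝ) : ℂ) * cexp (-((v * z) * s)) with hg
  have hgB : ∀ ε : ℝ, 0 < ε → ∀ v, 0 < v → ‖g ε v‖ ≤ c * ε ^ (-α) := by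
    intro ε hε v hv
    rw [hg]
    simp only
    rw [norm_mul, Complex.norm_real, Real.norm_of_nonneg (by positivity)]
    calc c * α * _ ≤ c * α * (ε ^ (-α) / α) := by
          gcongr
          exact norm_integral_Ioi_rpow_mul_cexp_le hα hε (re_ofReal_mul_pos hz hv)
      _ = c * ε ^ (-α) := by field_simp
  have hpos : ∀ ε : ℝ, 0 < ε → IsRayPositive z
      (fun v => ((Real.exp (-(c * ε ^ (-α))) : ℝ) : ℂ) * (cexp (g ε v) * 1)) := by
    intro ε hε
    refine (IsRayPositive.cexp_mul hz (hgB ε hε) (fun f hf => ?_)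
      (IsRayPositive.one hz hz')).const_mul (Real.exp_nonneg _)
    have := (hf.mixture_mul hz measurableSet_Ioi (Ioi_subset_Ioi hε.le)
      (integrableOn_Ioi_rpow_of_lt (a := -1 - α) (by linarith) hε)
      (fun s hs => Real.rpow_nonneg (hε.le.trans (le_of_lt hs)) _)).const_mul
      (c := c * α) (by positivity)
    simpa only [hg, mul_assoc] using this
  have hε : ∀ n : ℕ, (0 : ℝ) < 1 / ((n : ℝ) + 1) := fun n => by positivity
  have hseq : Tendsto (fun n : ℕ => 1 / ((n : ℝ) + 1)) atTop (𝓝[>] 0) :=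
    tendsto_nhdsWithin_iff.2 ⟨tendsto_one_div_add_atTop_nhds_zero_nat, Eventually.of_forall hε⟩
  refine IsRayPositive.of_tendsto hz (fun n => hpos _ (hε n)) (C := 1) (fun n v hv => ?_)
    (fun v hv => ?_)
  · rw [norm_mul, mul_one, Complex.norm_real, Real.norm_of_nonneg (Real.exp_nonneg _),
      Complex.norm_exp, ← Real.exp_add, Real.exp_le_one_iff]
    have h1 := (Complex.re_le_norm _).trans (hgB _ (hε n) v hv)
    linarith
  · have h := ((tendsto_truncated_bernstein hα hα' (re_ofReal_mul_pos hz hv)).const_mul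
      (c : ℂ)).comp hseq
    have hval : (c : ℂ) * -(Real.Gamma (1 - α) * ((v : ℂ) * z) ^ (α : ℂ)) =
        -(t * ((v : ℂ) * z) ^ (α : ℂ)) := by
      have : (t : ℂ) = c * Real.Gamma (1 - α) := by
        rw [← ofReal_mul, hc, div_mul_cancel₀ _ hG.ne']
      rw [this]; ring
    rw [hval] at h
    refine ((Complex.continuous_exp.tendsto _).comp h).congr fun n => ?_
    simp only [Function.comp, hg, mul_one]
    rw [Complex.ofReal_exp, ← Complex.exp_add]
    congr 1
    push_cast
    ring

theorem IsRayPositive.im_integral_cpow_neg_mul_nonneg {z : ℂ} {h : ℝ → ℂ} {a : ℝ} (ha : 0 < a)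
    (ha' : a < 1) (hz : 0 < z.re) (hh : IsRayPositive z h) :
    0 ≤ (z * ∫ v in Ioi (0 : ℝ),
      cexp (-(conj z * v)) * (((v : ℂ) * z) ^ (-(a : ℂ)) * h v)).im := by
  obtain ⟨C, hC⟩ := hh.bounded
  have hG : 0 < Real.Gamma a := Real.Gamma_pos_of_pos ha
  have hcut : ∀ n : ℕ, IntegrableOn (fun s : ℝ => s ^ (a - 1)) (Ioo 0 (n : ℝ)) := fun n =>
    (intervalIntegrable_iff_integrableOn_Ioo_of_le n.cast_nonneg).1
      (intervalIntegral.intervalIntegrable_rpow' (by linarith))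
  have hpos : ∀ n : ℕ, IsRayPositive z (fun v => (∫ s in Ioo 0 (n : ℝ),
      ((s ^ (a - 1) : ℝ) : ℂ) * cexp (-((v * z) * s))) * h v) := fun n =>
    hh.mixture_mul hz measurableSet_Ioo Ioo_subset_Ioi_self (hcut n)
      (fun s hs => Real.rpow_nonneg hs.1.le _)
  have hlim : Tendsto (fun n : ℕ => ∫ v in Ioi (0 : ℝ), cexp (-(((0 : ℝ) * z + conj z) * v)) *
      ((∫ s in Ioo 0 (n : ℝ), ((s ^ (a - 1) : ℝ) : ℂ) * cexp (-((v * z) * s))) * h v)) atTop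
      (𝓝 (∫ v in Ioi (0 : ℝ), cexp (-(((0 : ℝ) * z + conj z) * v)) *
        ((Real.Gamma a * ((v : ℂ) * z) ^ (-(a : ℂ))) * h v))) := by
    refine tendsto_integral_of_dominated_convergence
      (fun v => Real.Gamma a * z.re ^ (-a) * C * (v ^ ((1 - a) - 1) * Real.exp (-(z.re * v))))
      (fun n => ((hpos n).integrableOn hz le_rfl).aestronglyMeasurable)
      ((integrableOn_rpow_mul_exp_neg (by linarith) hz).const_mul _) (fun n => ?_) ?_
    · filter_upwards [ae_restrict_mem measurableSet_Ioi] with v hv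
      have hv' : 0 < v := hv
      have hre := re_ofReal_mul_pos hz hv'
      have hmix : ‖∫ s in Ioo 0 (n : ℝ), ((s ^ (a - 1) : ℝ) : ℂ) * cexp (-((v * z) * s))‖ ≤
          Real.Gamma a * z.re ^ (-a) * v ^ (-a) := by
        calc _ ≤ ∫ s in Ioo 0 (n : ℝ), s ^ (a - 1) * Real.exp (-((v * z.re) * s)) := by
              refine norm_integral_le_of_norm_le
                ((integrableOn_rpow_mul_exp_neg ha (by positivity)).mono_set
                  Ioo_subset_Ioi_self) ?_
              filter_upwards [ae_restrict_mem measurableSet_Ioo] with s hs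
              rw [norm_mul, norm_exp_neg_mul_ofReal, Complex.norm_real,
                Real.norm_of_nonneg (Real.rpow_nonneg hs.1.le _), Complex.re_ofReal_mul]
          _ ≤ ∫ s in Ioi 0, s ^ (a - 1) * Real.exp (-((v * z.re) * s)) := by
              refine setIntegral_mono_set (integrableOn_rpow_mul_exp_neg ha (by positivity)) ?_
                (Eventually.of_forall Ioo_subset_Ioi_self)
              filter_upwards [ae_restrict_mem measurableSet_Ioi] with s hs
              have hs' : 0 < s := hs
              simp only [Pi.zero_apply]
              positivity
          _ = _ := by
              rw [Real.integral_rpow_mul_exp_neg_mul_Ioi ha (by positivity), one_div,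
                Real.inv_rpow (by positivity), Real.mul_rpow hv'.le hz.le, Real.rpow_neg hz.le,
                Real.rpow_neg hv'.le]
              field_simp
      rw [norm_mul, norm_mul, show 1 - a - 1 = -a by ring]
      calc _ ≤ Real.exp (-(z.re * v)) * ((Real.Gamma a * z.re ^ (-a) * v ^ (-a)) * C) := by
            gcongr
            · exact norm_ray_kernel_le hz le_rfl hv'
            · exact hC v hv'
        _ = _ := by ring
    · filter_upwards [ae_restrict_mem measurableSet_Ioi] with v hv
      have hre := re_ofReal_mul_pos hz hv
      refine Tendsto.const_mul _ (Tendsto.mul_const _ ?_)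
      rw [← integral_rpow_mul_cexp_neg ha hre]
      have hc := (aecover_Iio (μ := volume.restrict (Ioi (0 : ℝ)))
        (tendsto_natCast_atTop_atTop (R := ℝ))).integral_tendsto_of_countably_generated
        (integrableOn_rpow_mul_cexp_neg ha hre)
      refine hc.congr fun n => ?_
      rw [Measure.restrict_restrict measurableSet_Iio, inter_comm, Ioi_inter_Iio]
  have hnonneg := ge_of_tendsto' ((Complex.continuous_im.tendsto _).comp (hlim.const_mul z))
    fun n => (hpos n).im_nonneg 0 le_rfl
  have heq : (∫ v in Ioi (0 : ℝ), cexp (-(((0 : ℝ) * z + conj z) * v)) *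
        ((Real.Gamma a * ((v : ℂ) * z) ^ (-(a : ℂ))) * h v)) = Real.Gamma a *
      ∫ v in Ioi (0 : ℝ), cexp (-(conj z * v)) * (((v : ℂ) * z) ^ (-(a : ℂ)) * h v) := by
    rw [← integral_const_mul]
    congr with v
    rw [ofReal_zero, zero_mul, zero_add]
    ring
  rw [heq, mul_left_comm, Complex.im_ofReal_mul] at hnonneg
  exact nonneg_of_mul_nonneg_right hnonneg hG

/-! ### Sign of the derivative and conclusion -/

theorem ofReal_mul_cexp_cpow {v ψ : ℝ} (hv : 0 < v) (hψ : -Real.pi < ψ) (hψ' : ψ ≤ Real.pi)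
    (x : ℝ) :
    ((v : ℂ) * cexp (ψ * I)) ^ (x : ℂ) = ((v ^ x : ℝ) : ℂ) * cexp (ψ * x * I) := by
  have hlog : Complex.log (cexp (ψ * I)) = ψ * I := by
    rw [Complex.log_exp] <;> simpa
  have hne : (v : ℂ) * cexp (ψ * I) ≠ 0 :=
    mul_ne_zero (ofReal_ne_zero.2 hv.ne') (Complex.exp_ne_zero _)
  rw [Complex.cpow_def_of_ne_zero hne, Complex.log_ofReal_mul hv (Complex.exp_ne_zero _), hlog,
    Real.rpow_def_of_pos hv, Complex.ofReal_exp, ← Complex.exp_add]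
  congr 1
  push_cast
  ring

theorem im_stretchedLaplace_nonneg_of_lt {α γ t : ℝ} (hα : 0 < α) (hα' : α < 1 / 2) (hγ : 0 ≤ γ)
    (hγ' : γ < Real.pi * α) (ht : 0 < t) :
    0 ≤ (cexp (γ * I) ^ 2 * stretchedLaplace α (α + α) (t * cexp (γ * I)) 1).im := by
  have hpi := Real.pi_pos
  set ψ : ℝ := γ / (2 * α) with hψdef
  have hψ0 : 0 ≤ ψ := by positivity
  have hψ : ψ < Real.pi / 2 := by
    rw [hψdef, div_lt_iff₀ (by positivity)]; linarith
  have hψα : ψ * (2 * α) = γ := by rw [hψdef]; field_simp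
  set z : ℂ := cexp (ψ * I) with hz
  have hzre : 0 < z.re := by
    rw [hz, Complex.exp_ofReal_mul_I_re]
    exact Real.cos_pos_of_mem_Ioo ⟨by linarith, hψ⟩
  have hzim : 0 ≤ z.im := by
    rw [hz, Complex.exp_ofReal_mul_I_im]
    exact Real.sin_nonneg_of_nonneg_of_le_pi hψ0 (by linarith)
  have hconj : conj z = cexp ((-ψ : ℝ) * I) := by
    rw [hz, ← Complex.exp_conj]; simp
  have hpos := (isRayPositive_cexp_neg_cpow hα (by linarith) ht hzre
    hzim).im_integral_cpow_neg_mul_nonneg (a := 1 - 2 * α) (by linarith) (by linarith) hzre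
  convert hpos using 2
  rw [stretchedLaplace_rotate hα (by linarith) (by linarith) _ (ψ := -ψ)
    (by rw [abs_neg, abs_of_nonneg hψ0]; exact hψ), stretchedLaplace, ← hconj,
    ← integral_const_mul, ← integral_const_mul, ← integral_const_mul]
  refine setIntegral_congr_fun measurableSet_Ioi fun v hv => ?_
  have hcp : ((v : ℂ) * z) ^ (α : ℂ) = ((v ^ α : ℝ) : ℂ) * cexp (ψ * α * I) :=
    ofReal_mul_cexp_cpow hv (by linarith) (by linarith) α
  have hcp' : ((v : ℂ) * z) ^ (-((1 - 2 * α : ℝ) : ℂ)) =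
      ((v ^ (α + α - 1) : ℝ) : ℂ) * cexp (ψ * (α + α - 1 : ℝ) * I) := by
    rw [← ofReal_mul_cexp_cpow hv (by linarith) (by linarith) (α + α - 1), ← ofReal_neg]
    congr 2; ring
  have hγc : (γ : ℂ) = ψ * (2 * α) := by rw [← hψα]; push_cast; ring
  have hw : (t : ℂ) * cexp (γ * I) * cexp ((-ψ : ℝ) * α * I) * ((v ^ α : ℝ) : ℂ) =
      t * (((v ^ α : ℝ) : ℂ) * cexp (ψ * α * I)) := by
    have : cexp (ψ * α * I) = cexp (γ * I) * cexp ((-ψ : ℝ) * α * I) := by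
      rw [← Complex.exp_add, hγc]; congr 1; push_cast; ring
    rw [this]; ring
  have hc : cexp (γ * I) ^ 2 * cexp ((-ψ : ℝ) * (α + α : ℝ) * I) =
      z * cexp (ψ * (α + α - 1 : ℝ) * I) := by
    rw [hz, ← Complex.exp_nat_mul, ← Complex.exp_add, ← Complex.exp_add, hγc]
    congr 1; push_cast; ring
  rw [hcp, hcp', hw]
  linear_combination (((v ^ (α + α - 1) : ℝ) : ℂ) *
    cexp (-(t * (((v ^ α : ℝ) : ℂ) * cexp (ψ * α * I)))) * cexp (-(conj z * v))) * hc

theorem im_stretchedLaplace_nonneg {α γ t : ℝ} (hα : 0 < α) (hα' : α < 1 / 2) (hγ : 0 ≤ γ)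
    (hγ' : γ ≤ Real.pi * α) (ht : 0 < t) :
    0 ≤ (cexp (γ * I) ^ 2 * stretchedLaplace α (α + α) (t * cexp (γ * I)) 1).im := by
  have hpi := Real.pi_pos
  have hπα : 0 < Real.pi * α := by positivity
  rcases hγ'.lt_or_eq with h | rfl
  · exact im_stretchedLaplace_nonneg_of_lt hα hα' hγ h ht
  have hcont : ContinuousAt (fun γ : ℝ =>
      (cexp (γ * I) ^ 2 * stretchedLaplace α (α + α) (t * cexp (γ * I)) 1).im)
      (Real.pi * α) := by
    refine Complex.continuous_im.continuousAt.comp (ContinuousAt.mul (by fun_prop) ?_)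
    refine continuousAt_stretchedLaplace_comp (by linarith) (by fun_prop) ?_
    have hI : Ioo (-(Real.pi / 2)) (Real.pi / 2) ∈ 𝓝 (Real.pi * α) :=
      Ioo_mem_nhds (by linarith) (by nlinarith)
    filter_upwards [hI] with x hx
    rw [Complex.re_ofReal_mul, Complex.exp_ofReal_mul_I_re]
    exact mul_nonneg ht.le (Real.cos_nonneg_of_mem_Icc ⟨hx.1.le, hx.2.le⟩)
  refine ge_of_tendsto (hcont.tendsto.mono_left (nhdsWithin_le_nhds (s := Iio (Real.pi * α)))) ?_
  filter_upwards [Ioo_mem_nhdsLT hπα] with x hx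
  exact im_stretchedLaplace_nonneg_of_lt hα hα' hx.1.le hx.2 ht

theorem antitoneOn_im_stretchedLaplace {α γ : ℝ} (hα : 0 < α) (hα' : α < 1 / 2) (hγ : 0 ≤ γ)
    (hγ' : γ ≤ Real.pi * α) :
    AntitoneOn (fun t : ℝ => (cexp (γ * I) * stretchedLaplace α α (t * cexp (γ * I)) 1).im)
      (Ioi 0) := by
  have hpi := Real.pi_pos
  have hu : 0 ≤ (cexp (γ * I)).re := by
    rw [Complex.exp_ofReal_mul_I_re]
    exact Real.cos_nonneg_of_mem_Icc ⟨by linarith, by nlinarith⟩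
  have hd : ∀ t : ℝ, 0 < t → HasDerivAt
      (fun t : ℝ => (cexp (γ * I) * stretchedLaplace α α (t * cexp (γ * I)) 1).im)
      (-(cexp (γ * I) ^ 2 * stretchedLaplace α (α + α) (t * cexp (γ * I)) 1).im) t := by
    intro t ht
    have h := (hasDerivAt_stretchedLaplace hα hα hu ht).const_mul (cexp (γ * I))
    refine (Complex.imCLM.hasFDerivAt.comp_hasDerivAt t h).congr_deriv ?_
    rw [Complex.imCLM_apply, ← Complex.neg_im]
    congr 1; ring
  refine antitoneOn_of_deriv_nonpos (convex_Ioi 0)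
    (fun t ht => (hd t ht).continuousAt.continuousWithinAt) ?_ ?_
  · rw [interior_Ioi]
    exact fun t ht => (hd t ht).differentiableAt.differentiableWithinAt
  · rw [interior_Ioi]
    intro t ht
    rw [(hd t ht).deriv, neg_nonpos]
    exact im_stretchedLaplace_nonneg hα hα' hγ hγ' ht

theorem integrableOn_stretchedLaplace {α β : ℝ} (hα : 0 < α) (hα' : α < 1) (hβ : 0 < β) (w : ℂ)
    {z : ℂ} (hz : 0 < z.re) :
    IntegrableOn (fun y : ℝ => ((y ^ (β - 1) : ℝ) : ℂ) *
      (cexp (-(w * (y ^ α : ℝ))) * cexp (-(z * y)))) (Ioi 0) := by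
  refine (integrableOn_rpow_mul_exp_rpow_sub hα hα' hβ hz (-w.re)).mono' (by fun_prop) ?_
  filter_upwards [ae_restrict_mem measurableSet_Ioi] with y hy
  have hy' : 0 < y := hy
  rw [norm_mul, norm_mul, norm_exp_neg_mul_ofReal, norm_exp_neg_mul_ofReal, Complex.norm_real,
    Real.norm_of_nonneg (by positivity), ← Real.exp_add, neg_mul, ← sub_eq_add_neg]

theorem im_stretchedLaplace_ofReal (α β t : ℝ) : (stretchedLaplace α β t 1).im = 0 := by
  have : stretchedLaplace α β t 1 = ((∫ y in Ioi (0 : ℝ), y ^ (β - 1) *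
      (Real.exp (-(t * y ^ α)) * Real.exp (-(1 * y))) : ℝ) : ℂ) := by
    rw [stretchedLaplace, ← integral_complex_ofReal]
    push_cast
    rfl
  rw [this, ofReal_im]

theorem GalphaPlus_eq_stretchedLaplace {α r : ℝ} (hα : 0 < α) (hα' : α < 1) (hr : 0 < r) :
    GalphaPlus α r = (2 * Real.pi * I)⁻¹ * ((r : ℂ)⁻¹ *
      (stretchedLaplace α 1 ((-r ^ (1 - α) : ℝ) : ℂ) 1 -
        stretchedLaplace α 1
          ((r ^ (1 - α) : ℝ) * cexp ((Real.pi * (1 - 2 * α) : ℝ) * I)) 1)) := by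
  have hi := integrableOn_stretchedLaplace hα hα' one_pos
  rw [stretchedLaplace, stretchedLaplace, ← integral_sub (hi _ (by simp)) (hi _ (by simp)),
    ← integral_const_mul, GalphaPlus]
  congr 1
  refine setIntegral_congr_fun measurableSet_Ioi fun y hy => ?_
  have hy' : 0 < y := hy
  have h1 : (r : ℂ) ^ (1 - (α : ℂ)) = ((r ^ (1 - α) : ℝ) : ℂ) := by
    rw [Complex.ofReal_cpow hr.le]; push_cast; rfl
  have h2 : (y : ℂ) ^ (α : ℂ) = ((y ^ α : ℝ) : ℂ) := (Complex.ofReal_cpow hy'.le α).symm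
  have h3 : cexp ((Real.pi * (1 - 2 * α) : ℝ) * I) = -cexp (-(2 * Real.pi * α : ℂ) * I) := by
    rw [show ((Real.pi * (1 - 2 * α) : ℝ) : ℂ) * I =
      -(2 * Real.pi * α : ℂ) * I + Real.pi * I by push_cast; ring, Complex.exp_add,
      Complex.exp_pi_mul_I, mul_neg_one]
  simp only [h1, h2, h3, sub_self, Real.rpow_zero, ofReal_one, one_mul, ofReal_neg]
  rw [show -(-((r ^ (1 - α) : ℝ) : ℂ) * ((y ^ α : ℝ) : ℂ)) =
      ((r ^ (1 - α) : ℝ) : ℂ) * ((y ^ α : ℝ) : ℂ) by ring,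
    show -(((r ^ (1 - α) : ℝ) : ℂ) * -cexp (-(2 * Real.pi * α : ℂ) * I) * ((y ^ α : ℝ) : ℂ)) =
      cexp (-(2 * Real.pi * α : ℂ) * I) * ((r ^ (1 - α) : ℝ) : ℂ) * ((y ^ α : ℝ) : ℂ) by ring]
  ring

theorem rpow_mul_re_GalphaPlus {α r : ℝ} (hα : 0 < α) (hα' : α < 1) (hr : 0 < r) :
    r ^ α * (GalphaPlus α r).re = α / (2 * Real.pi) *
      (cexp ((Real.pi * (1 - 2 * α) : ℝ) * I) * stretchedLaplace α α
        ((r ^ (1 - α) : ℝ) * cexp ((Real.pi * (1 - 2 * α) : ℝ) * I)) 1).im := by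
  have hpi := Real.pi_pos
  set u : ℂ := cexp ((Real.pi * (1 - 2 * α) : ℝ) * I) with hu
  set T : ℝ := r ^ (1 - α) with hT
  have hrT : r ^ α * T = r := by
    rw [hT, ← Real.rpow_add hr, add_sub_cancel, Real.rpow_one]
  have hcoef : ∀ x : ℂ, ((2 * Real.pi * I)⁻¹ * ((r : ℂ)⁻¹ * x)).re =
      (2 * Real.pi * r)⁻¹ * x.im := by
    intro x
    have : (2 * Real.pi * I)⁻¹ * ((r : ℂ)⁻¹ * x) = (((2 * Real.pi * r)⁻¹ : ℝ) : ℂ) * (-I * x) := by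
      push_cast
      rw [mul_inv, mul_inv, mul_inv, mul_inv, Complex.inv_I]
      ring
    rw [this, Complex.re_ofReal_mul]
    simp
  rw [GalphaPlus_eq_stretchedLaplace hα hα' hr, hcoef, Complex.sub_im, im_stretchedLaplace_ofReal,
    stretchedLaplace_one_eq hα hα', ← hT, ← hu,
    show (T : ℂ) * u * α * stretchedLaplace α α (T * u) 1 =
      ((T * α : ℝ) : ℂ) * (u * stretchedLaplace α α (T * u) 1) by push_cast; ring,
    Complex.sub_im, Complex.one_im, Complex.im_ofReal_mul]
  set m := (u * stretchedLaplace α α (T * u) 1).im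
  calc r ^ α * ((2 * Real.pi * r)⁻¹ * (0 - (0 - T * α * m)))
      = (r ^ α * T) * (2 * Real.pi * r)⁻¹ * (α * m) := by ring
    _ = α / (2 * Real.pi) * m := by rw [hrT]; field_simp

/-- For `α ∈ [1/3, 1/2]`, `r ↦ r^α Re(G_α(-r^+))` is decreasing on `(0,∞)`. -/
theorem GalphaPlus_weighted_re_antitone (α : ℝ) (hα : α ∈ Set.Icc (1/3 : ℝ) (1/2)) :
    AntitoneOn (fun r : ℝ => r ^ α * (GalphaPlus α r).re) (Set.Ioi 0) := by
  obtain ⟨h₁, h₂⟩ := hα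
  have hpi := Real.pi_pos
  have hα0 : 0 < α := by linarith
  have hα1 : α < 1 := by linarith
  intro r hr s hs hrs
  have hr' : 0 < r := hr
  have hs' : 0 < s := hs
  simp only
  rw [rpow_mul_re_GalphaPlus hα0 hα1 hr', rpow_mul_re_GalphaPlus hα0 hα1 hs']
  refine mul_le_mul_of_nonneg_left ?_ (by positivity)
  rcases h₂.lt_or_eq with h | rfl
  · refine antitoneOn_im_stretchedLaplace (γ := Real.pi * (1 - 2 * α)) hα0 h
      (mul_nonneg hpi.le (by linarith)) (mul_le_mul_of_nonneg_left (by linarith) hpi.le)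
      (Real.rpow_pos_of_pos hr' _) (Real.rpow_pos_of_pos hs' _)
      (Real.rpow_le_rpow hr'.le hrs (by linarith))
  · have hone : cexp ((Real.pi * (1 - 2 * (1 / 2 : ℝ)) : ℝ) * I) = 1 := by norm_num
    rw [hone]
    simp only [one_mul, mul_one, im_stretchedLaplace_ofReal, le_refl]
end
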